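/- arXiv:1605.01418 — 7 statements merged into one kernel-verified Lean document; each statement's English description precedes it below -/
import Mathlib

section
/- Let A be an m×n real matrix with rows a_1,…,a_m satisfying ‖a_i‖₂ = 1 for all i, let b ∈ ℝᵐ, and suppose the polyhedron P = {x ∈ ℝⁿ : Ax ≤ b} is nonempty. Fix λ ∈ (0,2] and a constant L_∞ > 0 such that d(x,P) ≤ L_∞‖(Ax−b)⁺‖_∞ for all x ∈ ℝⁿ. Define a sequence by choosing, at each step k, an index i_k maximizing a_iᵀx_k − b_i over i ∈ {1,…,m}, and setting x_{k+1} = x_k − λ·(a_{i_k}ᵀx_k − b_{i_k})⁺·a_{i_k}. Then for every k ≥ 0, d(x_k,P)² ≤ (1 − (2λ − λ²)/L_∞²)^k · d(x_0,P)². -/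
open scoped RealInnerProductSpace

/-- Linear convergence of the relaxation (Motzkin) method with projection
parameter `lam ∈ (0,2]`, in terms of the Hoffman constant `Linf`. -/
theorem motzkin_linear_convergence {m n : ℕ} (hm : 0 < m)
    (a : Fin m → EuclideanSpace ℝ (Fin n)) (b : Fin m → ℝ)
    (ha : ∀ i, ‖a i‖ = 1)
    (P : Set (EuclideanSpace ℝ (Fin n)))
    (hP : P = {x | ∀ i, ⟪a i, x⟫ ≤ b i})
    (hPne : P.Nonempty)
    (lam : ℝ) (hlam0 : 0 < lam) (hlam2 : lam ≤ 2)
    (Linf : ℝ) (hLinf : 0 < Linf)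
    (hHoff : ∀ x : EuclideanSpace ℝ (Fin n),
      Metric.infDist x P ≤ Linf * (⨆ i, max (⟪a i, x⟫ - b i) 0))
    (x : ℕ → EuclideanSpace ℝ (Fin n)) (idx : ℕ → Fin m)
    (hidx : ∀ k i, ⟪a i, x k⟫ - b i ≤ ⟪a (idx k), x k⟫ - b (idx k))
    (hiter : ∀ k, x (k + 1) =
      x k - (lam * max (⟪a (idx k), x k⟫ - b (idx k)) 0) • a (idx k)) :
    ∀ k : ℕ, (Metric.infDist (x k) P) ^ 2 ≤
      (1 - (2 * lam - lam ^ 2) / Linf ^ 2) ^ k * (Metric.infDist (x 0) P) ^ 2 := by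
  have hcl : IsClosed P := by
    rw [hP, Set.setOf_forall]
    exact isClosed_iInter fun i => isClosed_le (by fun_prop) continuous_const
  set q : ℝ := 1 - (2 * lam - lam ^ 2) / Linf ^ 2 with hq
  have step : ∀ k, (Metric.infDist (x (k + 1)) P) ^ 2 ≤ q * (Metric.infDist (x k) P) ^ 2 := by
    intro k
    obtain ⟨p, hpP, hp⟩ := hcl.exists_infDist_eq_dist hPne (x k)
    have hpi : ⟪a (idx k), p⟫ ≤ b (idx k) := by
      rw [hP] at hpP
      exact hpP (idx k)
    have h1 : Metric.infDist (x (k + 1)) P ≤ ‖x (k + 1) - p‖ := by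
      rw [← dist_eq_norm]
      exact Metric.infDist_le_dist_of_mem hpP
    have h0 : 0 ≤ Metric.infDist (x (k + 1)) P := Metric.infDist_nonneg
    have hd0 : 0 ≤ Metric.infDist (x k) P := Metric.infDist_nonneg
    have hr := hiter k
    have hH := hHoff (x k)
    have hs : (⨆ i, max (⟪a i, x k⟫ - b i) 0) ≤ max (⟪a (idx k), x k⟫ - b (idx k)) 0 := by
      haveI : Nonempty (Fin m) := ⟨idx k⟩
      exact ciSup_le fun i => max_le_max (hidx k i) le_rfl
    set r := max (⟪a (idx k), x k⟫ - b (idx k)) 0 with hrdef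
    have hr0 : 0 ≤ r := le_max_right _ _
    have hdr : Metric.infDist (x k) P ≤ Linf * r :=
      hH.trans (mul_le_mul_of_nonneg_left hs hLinf.le)
    have hin : r * r ≤ r * ⟪a (idx k), x k - p⟫ := by
      rw [inner_sub_right]
      rcases le_total (⟪a (idx k), x k⟫ - b (idx k)) 0 with h | h
      · have : r = 0 := max_eq_right h
        simp [this]
      · have : r = ⟪a (idx k), x k⟫ - b (idx k) := max_eq_left h
        exact mul_le_mul_of_nonneg_left (by linarith) hr0
    have hexp : ‖x (k + 1) - p‖ ^ 2 = ‖x k - p‖ ^ 2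
        - 2 * (lam * r * ⟪a (idx k), x k - p⟫) + (lam * r) ^ 2 := by
      have : x (k + 1) - p = (x k - p) - (lam * r) • a (idx k) := by
        rw [hr]; abel
      rw [this, norm_sub_sq_real, inner_smul_right, norm_smul, ha, real_inner_comm, mul_one,
        Real.norm_eq_abs, sq_abs]
    have hpd : ‖x k - p‖ = Metric.infDist (x k) P := by rw [hp, dist_eq_norm]
    have hsq : (Metric.infDist (x k) P) ^ 2 ≤ (Linf * r) ^ 2 := by gcongr
    have hdiv : (Metric.infDist (x k) P) ^ 2 / Linf ^ 2 ≤ r ^ 2 := by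
      rw [div_le_iff₀ (by positivity)]
      linarith [mul_pow Linf r 2]
    have h2 : (Metric.infDist (x (k + 1)) P) ^ 2 ≤ ‖x (k + 1) - p‖ ^ 2 := by gcongr
    have hc : 0 ≤ 2 * lam - lam ^ 2 := by nlinarith
    have h3 := mul_le_mul_of_nonneg_left hdiv hc
    have h4 := mul_le_mul_of_nonneg_left hin hlam0.le
    have h5 : q * (Metric.infDist (x k) P) ^ 2 = (Metric.infDist (x k) P) ^ 2
        - (2 * lam - lam ^ 2) * ((Metric.infDist (x k) P) ^ 2 / Linf ^ 2) := by
      rw [hq]; ring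
    rw [h5]
    rw [hexp, hpd] at h2
    nlinarith
  intro k
  rcases le_or_gt 0 q with h | h
  · induction k with
    | zero => simp
    | succ k ih =>
      calc _ ≤ _ := step k
        _ ≤ q * (q ^ k * (Metric.infDist (x 0) P) ^ 2) := mul_le_mul_of_nonneg_left ih h
        _ = _ := by ring
  · have hz : ∀ j, (Metric.infDist (x j) P) ^ 2 = 0 := by
      intro j
      have h1 := step j
      have h2 := sq_nonneg (Metric.infDist (x (j + 1)) P)
      have h3 := sq_nonneg (Metric.infDist (x j) P)
      nlinarith
    rw [hz, hz, mul_zero]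
end

section
/- Let A be an m×n real matrix with rows a_1,…,a_m satisfying ‖a_i‖₂ = 1 for all i, let b ∈ ℝᵐ, and suppose P = {x ∈ ℝⁿ : Ax ≤ b} is nonempty. Fix λ ∈ (0,2] and a constant L₂ > 0 such that d(x,P) ≤ L₂‖(Ax−b)⁺‖₂ for all x ∈ ℝⁿ. For x ∈ ℝⁿ and an index i, let T_i(x) = x − λ·(a_iᵀx − b_i)⁺·a_i. Then the average over i ∈ {1,…,m} of d(T_i(x),P)² satisfies (1/m)·Σ_{i=1}^m d(T_i(x),P)² ≤ (1 − (2λ − λ²)/(m·L₂²))·d(x,P)². -/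
open scoped RealInnerProductSpace

/-- One-step expected contraction of the randomized Kaczmarz method for linear
inequalities with projection parameter `lam ∈ (0,2]` (uniform row selection). -/
theorem randomizedKaczmarz_expected_contraction {m n : ℕ} (hm : 0 < m)
    (a : Fin m → EuclideanSpace ℝ (Fin n)) (b : Fin m → ℝ)
    (ha : ∀ i, ‖a i‖ = 1)
    (P : Set (EuclideanSpace ℝ (Fin n)))
    (hP : P = {x | ∀ i, ⟪a i, x⟫ ≤ b i})
    (hPne : P.Nonempty)
    (lam : ℝ) (hlam0 : 0 < lam) (hlam2 : lam ≤ 2)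
    (L2 : ℝ) (hL2 : 0 < L2)
    (hHoff : ∀ y : EuclideanSpace ℝ (Fin n),
      Metric.infDist y P ≤ L2 * Real.sqrt (∑ i, max (⟪a i, y⟫ - b i) 0 ^ 2))
    (x : EuclideanSpace ℝ (Fin n)) :
    (1 / (m : ℝ)) *
        ∑ i : Fin m,
          (Metric.infDist (x - (lam * max (⟪a i, x⟫ - b i) 0) • a i) P) ^ 2 ≤
      (1 - (2 * lam - lam ^ 2) / ((m : ℝ) * L2 ^ 2)) * (Metric.infDist x P) ^ 2 := by
  have hcl : IsClosed P := by
    rw [hP, Set.setOf_forall]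
    exact isClosed_iInter fun i => isClosed_le (by fun_prop) continuous_const
  obtain ⟨p, hpP, hp⟩ := hcl.exists_infDist_eq_dist hPne x
  have hpi : ∀ i, ⟪a i, p⟫ ≤ b i := by
    have h := hpP
    rw [hP] at h
    exact h
  have key : ∀ i, (Metric.infDist (x - (lam * max (⟪a i, x⟫ - b i) 0) • a i) P) ^ 2 ≤
      (Metric.infDist x P) ^ 2 - (2 * lam - lam ^ 2) * max (⟪a i, x⟫ - b i) 0 ^ 2 := by
    intro i
    have h1 : Metric.infDist (x - (lam * max (⟪a i, x⟫ - b i) 0) • a i) P ≤ _ :=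
      Metric.infDist_le_dist_of_mem hpP
    have h2 := pow_le_pow_left₀ Metric.infDist_nonneg h1 2
    refine h2.trans ?_
    have ht : max (⟪a i, x⟫ - b i) 0 * max (⟪a i, x⟫ - b i) 0 ≤
        max (⟪a i, x⟫ - b i) 0 * ⟪a i, x - p⟫ := by
      rw [inner_sub_right]
      rcases le_total (⟪a i, x⟫ - b i) 0 with h | h
      · simp [max_eq_right h]
      · rw [max_eq_left h]
        exact mul_le_mul_of_nonneg_left (by linarith [hpi i]) h
    generalize max (⟪a i, x⟫ - b i) 0 = t at ht ⊢
    have e : x - (lam * t) • a i - p = (x - p) - (lam * t) • a i := by abel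
    rw [hp, dist_eq_norm, dist_eq_norm, e, norm_sub_sq_real, inner_smul_right, norm_smul, ha i,
      real_inner_comm, mul_one, Real.norm_eq_abs, sq_abs]
    nlinarith [mul_le_mul_of_nonneg_left ht hlam0.le]
  have hsum := Finset.sum_le_sum fun i (_ : i ∈ Finset.univ) => key i
  rw [Finset.sum_sub_distrib, ← Finset.mul_sum] at hsum
  simp only [Finset.sum_const, Finset.card_univ, Fintype.card_fin, nsmul_eq_mul] at hsum
  have hS : 0 ≤ ∑ i, max (⟪a i, x⟫ - b i) 0 ^ 2 := Finset.sum_nonneg fun i _ => sq_nonneg _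
  have hD := pow_le_pow_left₀ Metric.infDist_nonneg (hHoff x) 2
  rw [mul_pow, Real.sq_sqrt hS] at hD
  have hm' : (0 : ℝ) < m := by exact_mod_cast hm
  have hc : 0 ≤ 2 * lam - lam ^ 2 := by nlinarith
  generalize ∑ i, max (⟪a i, x⟫ - b i) 0 ^ 2 = S at hsum hS hD
  have hD' : Metric.infDist x P ^ 2 / L2 ^ 2 ≤ S := by
    rw [div_le_iff₀ (by positivity)]
    linarith
  have h3 := mul_le_mul_of_nonneg_left hD' hc
  have e2 : (1 - (2 * lam - lam ^ 2) / ((m : ℝ) * L2 ^ 2)) * (Metric.infDist x P) ^ 2 =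
      (1 / (m : ℝ)) * (m * Metric.infDist x P ^ 2 -
        (2 * lam - lam ^ 2) * (Metric.infDist x P ^ 2 / L2 ^ 2)) := by
    field_simp
  rw [e2]
  exact mul_le_mul_of_nonneg_left (by linarith) (by positivity)
end

section
/- Let A be an m×n real matrix with rows a_1,…,a_m satisfying ‖a_i‖₂ = 1 for all i, let b ∈ ℝᵐ, suppose P = {x ∈ ℝⁿ : Ax ≤ b} is nonempty, fix λ ∈ (0,2], a sample size β with 1 ≤ β ≤ m, and a constant L₂ > 0 such that d(y,P) ≤ L₂‖(Ay−b)⁺‖₂ for all y ∈ ℝⁿ. Fix x ∈ ℝⁿ, let s be the number of indices i with a_iᵀx ≤ b_i, and let V = max(m − s, m − β + 1). For each subset τ ⊆ {1,…,m} with |τ| = β, let i*(τ) be an index in τ maximizing a_iᵀx − b_i over i ∈ τ, and let x'(τ) = x − λ·(a_{i*(τ)}ᵀx − b_{i*(τ)})⁺·a_{i*(τ)}. Then the average of d(x'(τ),P)² over all C(m,β) subsets τ of size β satisfies (1/C(m,β))·Σ_τ d(x'(τ),P)² ≤ (1 − (2λ − λ²)/(V·L₂²))·d(x,P)². -/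
open scoped RealInnerProductSpace

lemma SKM_choose_bound (m β : ℕ) (hβ1 : 1 ≤ β) (hβm : β ≤ m) (k : ℕ) (hk : k ≤ m - β + 1) :
    ((m - k).choose β : ℝ) * ((m : ℝ) - β + 1) ≤ ((m : ℝ) - β + 1 - k) * (m.choose β : ℝ) := by
  induction k with
  | zero => simp [mul_comm]
  | succ k ih =>
    have ih := ih (by omega)
    obtain ⟨d, hd⟩ : ∃ d, m = β + k + d := ⟨m - β - k, by omega⟩
    have e1 : m - k = (β + d - 1) + 1 := by omega
    have e2 : m - (k + 1) = β + d - 1 := by omega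
    obtain ⟨c, rfl⟩ : ∃ c, β = c + 1 := ⟨β - 1, by omega⟩
    have e3 : c + 1 + d - 1 = c + d := by omega
    rw [e1, e3] at ih
    rw [e2, e3]
    have h := Nat.choose_mul_succ_eq (c + d) (c + 1)
    have e4 : c + d + 1 - (c + 1) = d := by omega
    rw [e4] at h
    have h' : ((c + d).choose (c + 1) : ℝ) * ((c : ℝ) + d + 1)
        = ((c + d + 1).choose (c + 1) : ℝ) * d := by exact_mod_cast h
    have hm : (m : ℝ) = c + 1 + k + d := by exact_mod_cast hd
    rw [hm] at ih ⊢
    push_cast at ih ⊢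
    set X := ((c + d).choose (c + 1) : ℝ)
    set Y := ((c + d + 1).choose (c + 1) : ℝ)
    set Z := (m.choose (c + 1) : ℝ)
    have hX : 0 ≤ X := Nat.cast_nonneg _
    have hc : (0 : ℝ) ≤ c := Nat.cast_nonneg _
    have hdd : (0 : ℝ) ≤ d := Nat.cast_nonneg _
    have hkk : (0 : ℝ) ≤ k := Nat.cast_nonneg _
    have h1 : X * (d + 1) ≤ Y * d := by nlinarith [mul_nonneg hX hc]
    have ih2 : Y * (k + d + 1) ≤ (d + 1) * Z := by nlinarith
    have h2 : X * (k + d + 1) * (d + 1) ≤ d * Z * (d + 1) := by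
      have a1 := mul_le_mul_of_nonneg_right h1 (by positivity : (0 : ℝ) ≤ k + d + 1)
      have a2 := mul_le_mul_of_nonneg_left ih2 hdd
      nlinarith
    have h3 := le_of_mul_le_mul_right h2 (by positivity)
    nlinarith

lemma SKM_avg {m : ℕ} (β : ℕ) (S : Finset (Fin m)) (w : Fin m → ℝ) (M : Finset (Fin m) → ℝ)
    (hM0 : ∀ τ, 0 ≤ M τ)
    (hM : ∀ τ ∈ Finset.powersetCard β (Finset.univ : Finset (Fin m)), ∀ i ∈ τ, w i ≤ M τ) :
    ((m.choose β : ℝ) - ((m - S.card).choose β : ℝ)) * ∑ i ∈ S, w i ≤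
      S.card * ∑ τ ∈ Finset.powersetCard β (Finset.univ : Finset (Fin m)), M τ := by
  classical
  set T := Finset.powersetCard β (Finset.univ : Finset (Fin m)) with hT
  let g : Fin m → ℝ := fun i => ∑ τ ∈ T, if i ∈ τ then ((τ ∩ S).card : ℝ)⁻¹ else 0
  have hgsym : ∀ i ∈ S, ∀ j ∈ S, g i = g j := by
    intro i hi j hj
    have hSS : S.map (Equiv.swap i j).toEmbedding = S := by
      ext z
      rw [Finset.mem_map_equiv, Equiv.symm_swap]
      rcases eq_or_ne z i with rfl | h1
      · simp [hi, hj]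
      rcases eq_or_ne z j with rfl | h2
      · simp [hi, hj]
      rw [Equiv.swap_apply_of_ne_of_ne h1 h2]
    refine Finset.sum_nbij' (fun τ => τ.map (Equiv.swap i j).toEmbedding)
      (fun τ => τ.map (Equiv.swap i j).toEmbedding) ?_ ?_ ?_ ?_ ?_
    · intro τ h; simpa [hT, Finset.mem_powersetCard] using h
    · intro τ h; simpa [hT, Finset.mem_powersetCard] using h
    · intro τ h; ext z; simp only [Finset.mem_map_equiv, Equiv.symm_swap, Equiv.swap_apply_self]
    · intro τ h; ext z; simp only [Finset.mem_map_equiv, Equiv.symm_swap, Equiv.swap_apply_self]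
    · intro τ h
      have e : τ.map (Equiv.swap i j).toEmbedding ∩ S
          = (τ ∩ S).map (Equiv.swap i j).toEmbedding := by
        rw [Finset.map_inter, hSS]
      rw [e, Finset.card_map]
      simp only [Finset.mem_map_equiv, Equiv.symm_swap, Equiv.swap_apply_right]
  have hgsum : ∑ i ∈ S, g i = (m.choose β : ℝ) - ((m - S.card).choose β : ℝ) := by
    have h1 : ∑ i ∈ S, g i = ∑ τ ∈ T, (1 - if τ ⊆ Sᶜ then (1 : ℝ) else 0) := by
      rw [Finset.sum_comm]
      refine Finset.sum_congr rfl fun τ _ => ?_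
      rw [← Finset.sum_filter, Finset.filter_mem_eq_inter, Finset.inter_comm S τ,
        Finset.sum_const, nsmul_eq_mul]
      by_cases h : τ ⊆ Sᶜ
      · have : τ ∩ S = ∅ := by
          rwa [← Finset.disjoint_iff_inter_eq_empty, ← Finset.subset_compl_iff_disjoint_right]
        simp [this, h]
      · have : (τ ∩ S).card ≠ 0 := by
          rw [Ne, Finset.card_eq_zero, ← Finset.disjoint_iff_inter_eq_empty,
            ← Finset.subset_compl_iff_disjoint_right]
          exact h
        have h' : ((τ ∩ S).card : ℝ) ≠ 0 := by exact_mod_cast this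
        simp [h, h']
    have h2 : T.filter (fun τ => τ ⊆ Sᶜ) = Finset.powersetCard β Sᶜ := by
      ext τ; simp [hT, Finset.mem_powersetCard, and_comm]
    rw [h1, Finset.sum_sub_distrib, ← Finset.sum_filter, h2]
    simp [hT, Finset.card_powersetCard, Finset.card_compl]
  have hmain : ∑ i ∈ S, g i * w i ≤ ∑ τ ∈ T, M τ := by
    have h1 : ∑ i ∈ S, g i * w i
        = ∑ τ ∈ T, ∑ i ∈ τ ∩ S, ((τ ∩ S).card : ℝ)⁻¹ * w i := by
      simp only [g, Finset.sum_mul]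
      rw [Finset.sum_comm]
      refine Finset.sum_congr rfl fun τ _ => ?_
      rw [Finset.inter_comm τ S, ← Finset.filter_mem_eq_inter, Finset.sum_filter]
      refine Finset.sum_congr rfl fun i _ => ?_
      split_ifs <;> simp
    rw [h1]
    refine Finset.sum_le_sum fun τ hτ => ?_
    calc _ ≤ ∑ i ∈ τ ∩ S, ((τ ∩ S).card : ℝ)⁻¹ * M τ := by
          refine Finset.sum_le_sum fun i hi => ?_
          exact mul_le_mul_of_nonneg_left (hM τ hτ i (Finset.mem_inter.1 hi).1) (by positivity)
      _ ≤ M τ := by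
          rw [Finset.sum_const, nsmul_eq_mul, ← mul_assoc]
          exact mul_le_of_le_one_left (hM0 τ) (mul_inv_le_one)
  have hcard : ∀ i ∈ S, (S.card : ℝ) * g i = ∑ j ∈ S, g j := by
    intro i hi
    rw [Finset.sum_congr rfl (fun j hj => hgsym j hj i hi), Finset.sum_const, nsmul_eq_mul]
  calc _ = (S.card : ℝ) * ∑ i ∈ S, g i * w i := by
        rw [← hgsum, Finset.mul_sum, Finset.mul_sum]
        refine Finset.sum_congr rfl fun i hi => ?_
        rw [← mul_assoc, hcard i hi]
    _ ≤ _ := mul_le_mul_of_nonneg_left hmain (by positivity)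

/-- Per-iteration expected contraction of the Sampling Kaczmarz–Motzkin method:
sample `β` constraints uniformly at random, project (parameter `lam`) onto the
most violated constraint of the sample. -/
theorem SKM_one_step_expected_contraction {m n : ℕ} (hm : 0 < m)
    (a : Fin m → EuclideanSpace ℝ (Fin n)) (b : Fin m → ℝ)
    (ha : ∀ i, ‖a i‖ = 1)
    (P : Set (EuclideanSpace ℝ (Fin n)))
    (hP : P = {x | ∀ i, ⟪a i, x⟫ ≤ b i})
    (hPne : P.Nonempty)
    (lam : ℝ) (hlam0 : 0 < lam) (hlam2 : lam ≤ 2)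
    (β : ℕ) (hβ1 : 1 ≤ β) (hβm : β ≤ m)
    (L2 : ℝ) (hL2 : 0 < L2)
    (hHoff : ∀ y : EuclideanSpace ℝ (Fin n),
      Metric.infDist y P ≤ L2 * Real.sqrt (∑ i, max (⟪a i, y⟫ - b i) 0 ^ 2))
    (x : EuclideanSpace ℝ (Fin n))
    (s : ℕ) (hs : s = (Finset.univ.filter fun i => ⟪a i, x⟫ ≤ b i).card)
    (V : ℕ) (hV : V = max (m - s) (m - β + 1))
    (istar : Finset (Fin m) → Fin m)
    (histar : ∀ τ ∈ Finset.powersetCard β (Finset.univ : Finset (Fin m)),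
      istar τ ∈ τ ∧ ∀ i ∈ τ, ⟪a i, x⟫ - b i ≤ ⟪a (istar τ), x⟫ - b (istar τ)) :
    (1 / (m.choose β : ℝ)) *
        ∑ τ ∈ Finset.powersetCard β (Finset.univ : Finset (Fin m)),
          (Metric.infDist
            (x - (lam * max (⟪a (istar τ), x⟫ - b (istar τ)) 0) • a (istar τ)) P) ^ 2 ≤
      (1 - (2 * lam - lam ^ 2) / ((V : ℝ) * L2 ^ 2)) * (Metric.infDist x P) ^ 2 := by
  classical
  have hclosed : IsClosed P := by
    rw [hP, Set.setOf_forall]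
    exact isClosed_iInter fun i => isClosed_le (by fun_prop) continuous_const
  obtain ⟨p, hpP, hp⟩ := hclosed.exists_infDist_eq_dist hPne x
  set T := Finset.powersetCard β (Finset.univ : Finset (Fin m)) with hT
  set w : Fin m → ℝ := fun i => max (⟪a i, x⟫ - b i) 0 ^ 2 with hw
  have hw0 : ∀ i, 0 ≤ w i := fun i => sq_nonneg _
  set D := Metric.infDist x P with hD
  have hstep : ∀ i, (Metric.infDist (x - (lam * max (⟪a i, x⟫ - b i) 0) • a i) P) ^ 2
      ≤ D ^ 2 - (2 * lam - lam ^ 2) * w i := by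
    intro i
    have hpi : ⟪a i, p⟫ ≤ b i := by
      have := hpP
      rw [hP] at this
      exact this i
    simp only [hw]
    set r := max (⟪a i, x⟫ - b i) 0 with hr
    have hr0 : 0 ≤ r := le_max_right _ _
    have hrr : r * r ≤ r * ⟪a i, x - p⟫ := by
      rw [inner_sub_right]
      rcases le_total (⟪a i, x⟫ - b i) 0 with h | h
      · rw [max_eq_right h] at hr; simp [hr]
      · rw [max_eq_left h] at hr
        exact mul_le_mul_of_nonneg_left (by linarith) hr0
    have h1 : Metric.infDist (x - (lam * r) • a i) P ≤ ‖(x - p) - (lam * r) • a i‖ := by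
      refine (Metric.infDist_le_dist_of_mem hpP).trans_eq ?_
      rw [dist_eq_norm]
      congr 1
      abel
    have h2 : ‖(x - p) - (lam * r) • a i‖ ^ 2
        = D ^ 2 - 2 * (lam * r * ⟪a i, x - p⟫) + (lam * r) ^ 2 := by
      rw [norm_sub_sq_real, hp, dist_eq_norm, inner_smul_right, norm_smul, ha i,
        real_inner_comm (x - p) (a i), mul_one, Real.norm_eq_abs, sq_abs]
    have h3 := pow_le_pow_left₀ Metric.infDist_nonneg h1 2
    nlinarith [mul_le_mul_of_nonneg_left hrr hlam0.le]
  set S := Finset.univ.filter (fun i => ¬ ⟪a i, x⟫ ≤ b i) with hS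
  have hScard : S.card = m - s := by
    have := Finset.card_filter_add_card_filter_not (s := (Finset.univ : Finset (Fin m)))
      (fun i => ⟪a i, x⟫ ≤ b i)
    rw [← hs, Finset.card_univ, Fintype.card_fin] at this
    rw [hS]; omega
  have hSw : ∑ i ∈ S, w i = ∑ i, w i := by
    refine Finset.sum_subset (Finset.subset_univ _) fun i _ hi => ?_
    have : ⟪a i, x⟫ ≤ b i := by simpa [hS] using hi
    simp only [hw]
    rw [max_eq_right (by linarith)]
    norm_num
  have hC : (0 : ℝ) < (m.choose β : ℝ) := by exact_mod_cast Nat.choose_pos hβm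
  have hVpos : (0 : ℝ) < V := by
    have : 0 < V := by rw [hV]; omega
    exact_mod_cast this
  have havg := SKM_avg β S w (fun τ => w (istar τ)) (fun τ => hw0 _) (by
    intro τ hτ i hi
    have := (histar τ hτ).2 i hi
    exact pow_le_pow_left₀ (le_max_right _ _) (max_le_max_right 0 this) 2)
  rw [hSw, ← hT] at havg
  have hW0 : 0 ≤ ∑ i, w i := Finset.sum_nonneg fun i _ => hw0 i
  have hM0 : 0 ≤ ∑ τ ∈ T, w (istar τ) := Finset.sum_nonneg fun i _ => hw0 _
  -- key inequality
  have hkey : (m.choose β : ℝ) * ∑ i, w i ≤ V * ∑ τ ∈ T, w (istar τ) := by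
    rcases Nat.eq_zero_or_pos S.card with h0 | hpos
    · rw [Finset.card_eq_zero] at h0
      rw [← hSw, h0]
      simp only [Finset.sum_empty, mul_zero]
      positivity
    have hposR : (0 : ℝ) < S.card := by exact_mod_cast hpos
    have hch : (S.card : ℝ) * (m.choose β : ℝ)
        ≤ V * ((m.choose β : ℝ) - ((m - S.card).choose β : ℝ)) := by
      rcases le_total S.card (m - β + 1) with h | h
      · have hb := SKM_choose_bound m β hβ1 hβm S.card h
        have hVe : (V : ℝ) = (m : ℝ) - β + 1 := by
          rw [hV, ← hScard, max_eq_right h]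
          push_cast [Nat.cast_sub hβm]
          ring
        rw [hVe]
        nlinarith
      · rw [Nat.choose_eq_zero_of_lt (by omega : m - S.card < β), hV, ← hScard, max_eq_left h]
        simp
    have h1 := mul_le_mul_of_nonneg_right hch hW0
    have h2 := mul_le_mul_of_nonneg_left havg hVpos.le
    refine le_of_mul_le_mul_left ?_ hposR
    nlinarith
  have hD2 : D ^ 2 ≤ L2 ^ 2 * ∑ i, w i := by
    have := pow_le_pow_left₀ Metric.infDist_nonneg (hHoff x) 2
    rwa [mul_pow, Real.sq_sqrt hW0] at this
  have hcl : 0 ≤ 2 * lam - lam ^ 2 := by nlinarith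
  have hsum : ∑ τ ∈ T, (Metric.infDist
      (x - (lam * max (⟪a (istar τ), x⟫ - b (istar τ)) 0) • a (istar τ)) P) ^ 2
      ≤ (m.choose β : ℝ) * D ^ 2 - (2 * lam - lam ^ 2) * ∑ τ ∈ T, w (istar τ) := by
    refine (Finset.sum_le_sum fun τ _ => hstep (istar τ)).trans_eq ?_
    rw [Finset.sum_sub_distrib, ← Finset.mul_sum, Finset.sum_const, nsmul_eq_mul, hT,
      Finset.card_powersetCard, Finset.card_univ, Fintype.card_fin]
  have hfin : (m.choose β : ℝ) * (D ^ 2 / (V * L2 ^ 2)) ≤ ∑ τ ∈ T, w (istar τ) := by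
    rw [← mul_div_assoc, div_le_iff₀ (by positivity)]
    have h1 := mul_le_mul_of_nonneg_left hD2 hC.le
    have h2 := mul_le_mul_of_nonneg_left hkey (sq_nonneg L2)
    nlinarith
  rw [one_div, inv_mul_le_iff₀ hC]
  refine hsum.trans ?_
  have h3 := mul_le_mul_of_nonneg_left hfin hcl
  have e : (m.choose β : ℝ) * ((1 - (2 * lam - lam ^ 2) / ((V : ℝ) * L2 ^ 2)) * D ^ 2)
      = (m.choose β : ℝ) * D ^ 2
        - (2 * lam - lam ^ 2) * ((m.choose β : ℝ) * (D ^ 2 / (V * L2 ^ 2))) := by ring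
  rw [e]
  linarith
end

section
/- Let m ≥ 1, 1 ≤ β ≤ m, and let r ∈ ℝᵐ be a vector with nonnegative entries, exactly s of which are zero (0 ≤ s ≤ m, and s < m unless r = 0). Then the average over all β-element subsets τ of {1,…,m} of (max_{i∈τ} r_i)² satisfies (1/C(m,β))·Σ_{τ : |τ|=β} (max_{i∈τ} r_i)² ≥ (1/(m−β+1)) · min{(m−β+1)/(m−s), 1} · ‖r‖₂², where for r = 0 both sides are 0. -/
/-- The maximum of `r` over a finite index set `τ` (defined as `0` for `τ = ∅`). -/
noncomputable def finsetMax {m : ℕ} (r : Fin m → ℝ) (τ : Finset (Fin m)) : ℝ :=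
  if h : τ.Nonempty then τ.sup' h r else 0

theorem weight_const {m : ℕ} (β : ℕ) (Z : Finset (Fin m)) (i j : Fin m) (hi : i ∉ Z) (hj : j ∉ Z) :
    (∑ τ ∈ Finset.powersetCard β (Finset.univ : Finset (Fin m)),
      (if i ∈ τ then (1 : ℝ) / ((τ \ Z).card : ℝ) else 0)) =
    ∑ τ ∈ Finset.powersetCard β (Finset.univ : Finset (Fin m)),
      (if j ∈ τ then (1 : ℝ) / ((τ \ Z).card : ℝ) else 0) := by
  have hZ : Z.map (Equiv.swap i j).toEmbedding = Z := by
    have h1 : Z.map (Equiv.swap i j).toEmbedding ⊆ Z := by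
      intro x hx
      obtain ⟨y, hy, rfl⟩ := Finset.mem_map.1 hx
      have h1 : y ≠ i := fun h => hi (h ▸ hy)
      have h2 : y ≠ j := fun h => hj (h ▸ hy)
      simpa [Equiv.swap_apply_of_ne_of_ne h1 h2] using hy
    exact Finset.eq_of_subset_of_card_le h1 (by simp)
  refine Finset.sum_equiv (Equiv.finsetCongr (Equiv.swap i j)) ?_ ?_
  · intro τ
    simp [Finset.mem_powersetCard]
  · intro τ _
    have hc : (τ.map (Equiv.swap i j).toEmbedding \ Z).card = (τ \ Z).card := by
      conv_lhs => rw [← hZ]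
      rw [← Finset.map_sdiff, Finset.card_map]
    have hm : j ∈ τ.map (Equiv.swap i j).toEmbedding ↔ i ∈ τ := by
      rw [Finset.mem_map_equiv]; simp
    simp only [Equiv.finsetCongr_apply, hc, hm]

theorem key_bound {m : ℕ} (β : ℕ) (r : Fin m → ℝ) (hr0 : ∀ i, 0 ≤ r i)
    (Z : Finset (Fin m)) (hZ : ∀ i ∈ Z, r i = 0) (hk : Z.card < β) (hβm : β ≤ m) :
    (m.choose β : ℝ) * ∑ i, (r i) ^ 2 ≤ ((m : ℝ) - Z.card) *
      ∑ τ ∈ Finset.powersetCard β (Finset.univ : Finset (Fin m)), (finsetMax r τ) ^ 2 := by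
  set P := Finset.powersetCard β (Finset.univ : Finset (Fin m)) with hP
  let c : Fin m → ℝ := fun i => ∑ τ ∈ P, (if i ∈ τ then (1 : ℝ) / ((τ \ Z).card : ℝ) else 0)
  have hpos : ∀ τ ∈ P, 0 < (τ \ Z).card := by
    intro τ hτ
    have := (Finset.mem_powersetCard.1 hτ).2
    have := Finset.le_card_sdiff Z τ
    omega
  have swap : ∀ f : Fin m → ℝ, ∑ i ∈ Zᶜ, c i * f i =
      ∑ τ ∈ P, (1 / ((τ \ Z).card : ℝ)) * ∑ i ∈ τ \ Z, f i := by
    intro f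
    simp only [c, Finset.sum_mul, Finset.mul_sum]
    rw [Finset.sum_comm]
    refine Finset.sum_congr rfl fun τ _ => ?_
    have : τ \ Z = Zᶜ.filter (fun i => i ∈ τ) := by
      ext x; simp [and_comm]
    conv_rhs => rw [this]
    rw [Finset.sum_filter, ← this]
    refine Finset.sum_congr rfl fun i _ => ?_
    split_ifs <;> simp
  have hZc : ((Zᶜ.card : ℕ) : ℝ) = (m : ℝ) - Z.card := by
    rw [Finset.card_compl, Fintype.card_fin, Nat.cast_sub (by omega)]
  have hsum : ∑ i ∈ Zᶜ, c i = (m.choose β : ℝ) := by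
    have := swap (fun _ => 1)
    simp only [mul_one] at this
    rw [this, Finset.sum_congr rfl (g := fun _ => (1 : ℝ))]
    · simp [hP]
    · intro τ hτ
      have h : ((τ \ Z).card : ℝ) ≠ 0 := by exact_mod_cast (hpos τ hτ).ne'
      simp only [Finset.sum_const, nsmul_eq_mul, mul_one]
      exact one_div_mul_cancel h
  have hc : ∀ i ∈ Zᶜ, ((m : ℝ) - Z.card) * c i = (m.choose β : ℝ) := by
    intro i hi
    rw [← hsum, ← hZc, ← nsmul_eq_mul, ← Finset.sum_const]
    refine Finset.sum_congr rfl fun j hj => ?_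
    exact weight_const β Z i j (by simpa using hi) (by simpa using hj)
  have hr : ∑ i, (r i) ^ 2 = ∑ i ∈ Zᶜ, (r i) ^ 2 := by
    symm
    refine Finset.sum_subset (Finset.subset_univ _) fun i _ hi => ?_
    rw [hZ i (by simpa using hi)]; simp
  have hle : ∑ i ∈ Zᶜ, c i * (r i) ^ 2 ≤ ∑ τ ∈ P, (finsetMax r τ) ^ 2 := by
    rw [swap]
    refine Finset.sum_le_sum fun τ hτ => ?_
    have h0 : (0 : ℝ) < ((τ \ Z).card : ℝ) := by exact_mod_cast hpos τ hτ
    rw [one_div, inv_mul_le_iff₀ h0, ← nsmul_eq_mul]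
    refine Finset.sum_le_card_nsmul _ _ _ fun i hi => ?_
    have hi' : i ∈ τ := (Finset.mem_sdiff.1 hi).1
    refine pow_le_pow_left₀ (hr0 i) ?_ 2
    rw [finsetMax, dif_pos ⟨i, hi'⟩]
    exact Finset.le_sup' r hi'
  have hnn : (0 : ℝ) ≤ (m : ℝ) - Z.card := by rw [← hZc]; positivity
  calc (m.choose β : ℝ) * ∑ i, (r i) ^ 2 = ((m : ℝ) - Z.card) * ∑ i ∈ Zᶜ, c i * (r i) ^ 2 := by
        rw [hr, Finset.mul_sum, Finset.mul_sum]
        refine Finset.sum_congr rfl fun i hi => ?_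
        rw [← hc i hi, mul_assoc]
    _ ≤ _ := mul_le_mul_of_nonneg_left hle hnn

/-- Lower bound on the expected squared maximum entry of a nonnegative residual
vector over a uniformly random `β`-element subset of the coordinates, where `s`
is the number of zero entries.  (For `r = 0` both sides are `0`.) -/
theorem avg_sq_max_lower_bound {m : ℕ} (hm : 1 ≤ m) (β : ℕ) (hβ1 : 1 ≤ β) (hβm : β ≤ m)
    (r : Fin m → ℝ) (hr0 : ∀ i, 0 ≤ r i)
    (s : ℕ) (hs : s = (Finset.univ.filter fun i => r i = 0).card) :
    (1 / (m.choose β : ℝ)) *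
        ∑ τ ∈ Finset.powersetCard β (Finset.univ : Finset (Fin m)), (finsetMax r τ) ^ 2 ≥
      (1 / ((m : ℝ) - β + 1)) * min (((m : ℝ) - β + 1) / ((m : ℝ) - s)) 1 *
        ∑ i, (r i) ^ 2 := by
  have hC : (0 : ℝ) < (m.choose β : ℝ) := by exact_mod_cast Nat.choose_pos hβm
  have hmb : (0 : ℝ) < (m : ℝ) - β + 1 := by
    have : (β : ℝ) ≤ m := by exact_mod_cast hβm
    linarith
  have hS : 0 ≤ ∑ i, (r i) ^ 2 := Finset.sum_nonneg fun i _ => sq_nonneg _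
  obtain ⟨Z, hZs, hZc⟩ := Finset.exists_subset_card_eq
    (s := Finset.univ.filter fun i => r i = 0) (n := min s (β - 1)) (by omega)
  have key := key_bound β r hr0 Z (fun i hi => (Finset.mem_filter.1 (hZs hi)).2)
    (by omega) hβm
  have hZm : (0 : ℝ) < (m : ℝ) - Z.card := by
    have : Z.card < m := by omega
    have : (Z.card : ℝ) < m := by exact_mod_cast this
    linarith
  have hfac : (1 / ((m : ℝ) - β + 1)) * min (((m : ℝ) - β + 1) / ((m : ℝ) - s)) 1
      ≤ 1 / ((m : ℝ) - Z.card) := by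
    rcases le_total s (β - 1) with h | h
    · have hz : Z.card = s := by omega
      rw [hz] at hZm ⊢
      calc _ ≤ (1 / ((m : ℝ) - β + 1)) * (((m : ℝ) - β + 1) / ((m : ℝ) - s)) :=
            mul_le_mul_of_nonneg_left (min_le_left _ _) (by positivity)
        _ = _ := by field_simp
    · have hz : (Z.card : ℝ) = β - 1 := by
        have : Z.card + 1 = β := by omega
        rw [← this]; push_cast; ring
      rw [hz, show (m : ℝ) - (β - 1) = m - β + 1 by ring]
      calc _ ≤ (1 / ((m : ℝ) - β + 1)) * 1 :=
            mul_le_mul_of_nonneg_left (min_le_right _ _) (by positivity)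
        _ = _ := mul_one _
  refine ge_iff_le.2 ((mul_le_mul_of_nonneg_right hfac hS).trans ?_)
  rw [one_div, one_div, inv_mul_le_iff₀ hZm, mul_left_comm, ← div_eq_inv_mul, le_div_iff₀ hC]
  linarith
end

section
/- Let A be an m×n integer matrix with rows a_1,…,a_m, let b ∈ ℤᵐ, and define the binary encoding length σ = Σ_{i,j} log₂(|A_{ij}| + 1) + Σ_i log₂(|b_i| + 1) + log₂(nm) + 2. If the system Ax ≤ b has no solution x ∈ ℝⁿ, then for every x ∈ ℝⁿ the maximum violation θ(x) = max{0, max_i (a_iᵀx − b_i)} satisfies θ(x) ≥ 2·2^{−σ}. -/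
theorem fm_between {ι : Type} [Fintype ι] (P N : ι → Prop) (u l : ι → ℝ)
    (h : ∀ p q, P p → N q → l q ≤ u p) :
    ∃ x : ℝ, (∀ p, P p → x ≤ u p) ∧ (∀ q, N q → l q ≤ x) := by
  classical
  by_cases hN : ∃ q, N q
  · obtain ⟨q0, hq0⟩ := hN
    have hne : (Finset.univ.filter N).Nonempty := ⟨q0, by simpa using hq0⟩
    refine ⟨(Finset.univ.filter N).sup' hne l, ?_, ?_⟩
    · intro p hp
      apply Finset.sup'_le
      intro q hq
      exact h p q hp (by simpa using hq)
    · intro q hq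
      exact Finset.le_sup' l (by simpa using hq)
  · by_cases hP : ∃ p, P p
    · obtain ⟨p0, hp0⟩ := hP
      have hne : (Finset.univ.filter P).Nonempty := ⟨p0, by simpa using hp0⟩
      refine ⟨(Finset.univ.filter P).inf' hne u, ?_, ?_⟩
      · intro p hp
        exact Finset.inf'_le u (by simpa using hp)
      · intro q hq
        exact absurd ⟨q, hq⟩ hN
    · exact ⟨0, fun p hp => absurd ⟨p, hp⟩ hP, fun q hq => absurd ⟨q, hq⟩ hN⟩

theorem fm_swap {ι κ : Type} [Fintype ι] [Fintype κ] (y : κ → ℝ) (W : κ → ι → ℝ) (c : ι → ℝ) :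
    ∑ i, (∑ k, y k * W k i) * c i = ∑ k, y k * ∑ i, W k i * c i := by
  simp_rw [Finset.sum_mul, Finset.mul_sum]
  rw [Finset.sum_comm]
  simp_rw [mul_assoc]

theorem fm_farkas (n : ℕ) : ∀ (ι : Type) [Fintype ι] (A : ι → Fin n → ℝ) (b : ι → ℝ),
    (¬ ∃ x : Fin n → ℝ, ∀ i, ∑ j, A i j * x j ≤ b i) →
    ∃ y : ι → ℝ, (∀ i, 0 ≤ y i) ∧ (∀ j, ∑ i, y i * A i j = 0) ∧ ∑ i, y i * b i < 0 := by
  classical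
  induction n with
  | zero =>
    intro ι _ A b h
    push Not at h
    obtain ⟨i, hi⟩ := h 0
    refine ⟨Pi.single i 1, ?_, fun j => j.elim0, ?_⟩
    · intro k
      by_cases hk : k = i
      · subst hk; simp
      · simp [hk]
    · simpa [Pi.single_apply] using hi
  | succ n ih =>
    intro ι _ A b h
    let W : ι ⊕ (ι × ι) → ι → ℝ := fun k => match k with
      | Sum.inl i => if A i 0 = 0 then Pi.single i 1 else 0
      | Sum.inr (p, q) => if 0 < A p 0 ∧ A q 0 < 0 then
          Pi.single p (-A q 0) + Pi.single q (A p 0) else 0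
    have hW0 : ∀ k i, 0 ≤ W k i := by
      rintro (i | ⟨p, q⟩) j
      · simp only [W]
        split_ifs
        · rw [Pi.single_apply]; split_ifs <;> norm_num
        · simp
      · simp only [W]
        split_ifs with hpq
        · rw [Pi.add_apply, Pi.single_apply, Pi.single_apply]
          split_ifs <;> linarith [hpq.1, hpq.2]
        · simp
    have hWs : ∀ p q (c : ι → ℝ), 0 < A p 0 → A q 0 < 0 →
        ∑ i, W (Sum.inr (p, q)) i * c i = - A q 0 * c p + A p 0 * c q := by
      intro p q c hp hq
      simp only [W, if_pos (And.intro hp hq)]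
      simp [add_mul, Finset.sum_add_distrib, Pi.single_apply]
    have hWz : ∀ p (c : ι → ℝ), A p 0 = 0 → ∑ i, W (Sum.inl p) i * c i = c p := by
      intro p c hp
      simp only [W, if_pos hp]
      simp [Pi.single_apply]
    have hWA : ∀ k, ∑ i, W k i * A i 0 = 0 := by
      rintro (i | ⟨p, q⟩)
      · by_cases hi : A i 0 = 0
        · rw [hWz i _ hi, hi]
        · simp [W, hi]
      · by_cases hpq : 0 < A p 0 ∧ A q 0 < 0
        · rw [hWs p q _ hpq.1 hpq.2]; ring
        · simp only [W, if_neg hpq]; simp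
    obtain ⟨y, hy0, hyA, hyb⟩ := ih (ι ⊕ (ι × ι)) (fun k j => ∑ i, W k i * A i j.succ)
      (fun k => ∑ i, W k i * b i) (by
        rintro ⟨x, hx⟩
        apply h
        have hx' : ∀ k, ∑ i, W k i * (∑ j, A i (Fin.succ j) * x j) ≤ ∑ i, W k i * b i := by
          intro k
          refine le_trans (le_of_eq ?_) (hx k)
          rw [← fm_swap]
        set r : ι → ℝ := fun i => ∑ j, A i (Fin.succ j) * x j with hr
        obtain ⟨x0, hu, hl⟩ := fm_between (fun p => 0 < A p 0) (fun q => A q 0 < 0)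
          (fun p => (b p - r p) / A p 0) (fun q => (b q - r q) / A q 0) (by
            intro p q hp hq
            have := hx' (Sum.inr (p, q))
            rw [hWs p q _ hp hq, hWs p q _ hp hq] at this
            rw [le_div_iff₀ hp, div_mul_eq_mul_div, div_le_iff_of_neg hq]
            linarith)
        refine ⟨Fin.cons x0 x, fun i => ?_⟩
        rw [Fin.sum_univ_succ]
        simp only [Fin.cons_zero, Fin.cons_succ]
        change A i 0 * x0 + r i ≤ b i
        rcases lt_trichotomy (A i 0) 0 with hi | hi | hi
        · have := hl i hi
          rw [div_le_iff_of_neg hi] at this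
          linarith
        · have := hx' (Sum.inl i)
          rw [hWz i _ hi, hWz i _ hi] at this
          rw [hi]; linarith
        · have := hu i hi
          rw [le_div_iff₀ hi] at this
          linarith)
    refine ⟨fun i => ∑ k, y k * W k i, ?_, ?_, ?_⟩
    · exact fun i => Finset.sum_nonneg fun k _ => mul_nonneg (hy0 k) (hW0 k i)
    · intro j
      rw [fm_swap]
      refine Fin.cases ?_ (fun j => ?_) j
      · simp [hWA]
      · exact hyA j
    · rw [fm_swap]; exact hyb


theorem fm_minimal {m n : ℕ} (A : Fin m → Fin n → ℝ) (b : Fin m → ℝ)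
    (h : ∃ y : Fin m → ℝ, (∀ i, 0 ≤ y i) ∧ (∀ j, ∑ i, y i * A i j = 0) ∧ ∑ i, y i * b i < 0) :
    ∃ y : Fin m → ℝ, ((∀ i, 0 ≤ y i) ∧ (∀ j, ∑ i, y i * A i j = 0) ∧ ∑ i, y i * b i < 0) ∧
      ∀ i0, y i0 ≠ 0 → ∀ z : Fin m → ℝ, (∀ i, y i = 0 → z i = 0) → z i0 = 0 →
        (∀ j, ∑ i, z i * A i j = 0) → z = 0 := by
  classical
  let supp : (Fin m → ℝ) → Finset (Fin m) := fun y => Finset.univ.filter (fun i => y i ≠ 0)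
  obtain ⟨y, hy, hmin'⟩ := WellFounded.has_min (measure fun y : Fin m → ℝ => (supp y).card).wf
    {y : Fin m → ℝ | (∀ i, 0 ≤ y i) ∧ (∀ j, ∑ i, y i * A i j = 0) ∧ ∑ i, y i * b i < 0} h
  have hmin : ∀ z : Fin m → ℝ, (∀ i, 0 ≤ z i) → (∀ j, ∑ i, z i * A i j = 0) →
      ∑ i, z i * b i < 0 → (∀ i, y i = 0 → z i = 0) → ∀ i0, y i0 ≠ 0 → z i0 ≠ 0 := by
    intro z h1 h2 h3 h4 i0 hi0 hz
    apply hmin' z ⟨h1, h2, h3⟩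
    change (supp z).card < (supp y).card
    apply Finset.card_lt_card
    rw [Finset.ssubset_iff_of_subset]
    · exact ⟨i0, by simp [supp, hi0], by simp [supp, hz]⟩
    · intro i
      simp only [supp, Finset.mem_filter, Finset.mem_univ, true_and]
      exact fun hh hh' => hh (h4 i hh')
  obtain ⟨hy0, hyA, hyb⟩ := hy
  have claim1 : ∀ z : Fin m → ℝ, (∀ i, y i = 0 → z i = 0) → (∀ j, ∑ i, z i * A i j = 0) →
      ∑ i, z i * b i ≤ 0 → (∃ i, z i < 0) → False := by
    rintro z hz hzA hzb ⟨i1, hi1⟩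
    obtain ⟨k, hk, hkmin⟩ := Finset.exists_min_image (Finset.univ.filter fun i => z i < 0)
      (fun i => y i / (- z i)) ⟨i1, by simpa using hi1⟩
    simp only [Finset.mem_filter, Finset.mem_univ, true_and] at hk hkmin
    set t := y k / (- z k) with ht
    have ht0 : 0 ≤ t := div_nonneg (hy0 k) (by linarith)
    refine hmin (fun i => y i + t * z i) ?_ ?_ ?_ ?_ k ?_ ?_
    · intro i
      by_cases hi : z i < 0
      · have := hkmin i hi
        rw [le_div_iff₀ (by linarith)] at this
        change 0 ≤ y i + t * z i
        linarith
      · exact add_nonneg (hy0 i) (mul_nonneg ht0 (by linarith))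
    · intro j
      simp only [add_mul, Finset.sum_add_distrib, mul_assoc, ← Finset.mul_sum, hyA, hzA]
      simp
    · simp only [add_mul, Finset.sum_add_distrib, mul_assoc, ← Finset.mul_sum]
      nlinarith
    · intro i hi
      simp [hi, hz i hi]
    · exact fun h => hk.ne (hz k h)
    · have : z k ≠ 0 := hk.ne
      rw [ht]; field_simp; ring
  have claim2 : ∀ i0, y i0 ≠ 0 → ∀ z : Fin m → ℝ, (∀ i, y i = 0 → z i = 0) → z i0 = 0 →
        (∀ j, ∑ i, z i * A i j = 0) → ∑ i, z i * b i ≤ 0 → z = 0 := by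
    intro i0 hi0 z hz hz0 hzA hzb
    by_cases hneg : ∃ i, z i < 0
    · exact (claim1 z hz hzA hzb hneg).elim
    push Not at hneg
    rcases hzb.lt_or_eq with hlt | heq
    · exact (hmin z hneg hzA hlt hz i0 hi0 hz0).elim
    · by_contra hne
      obtain ⟨i, hi⟩ := Function.ne_iff.mp hne
      refine claim1 (-z) (fun i h => by simp [hz i h]) (fun j => by simp [hzA j])
        (by simp [heq]) ⟨i, ?_⟩
      have := lt_of_le_of_ne (hneg i) (Ne.symm hi)
      simpa using this
  refine ⟨y, ⟨hy0, hyA, hyb⟩, fun i0 hi0 z hz hz0 hzA => ?_⟩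
  rcases le_total (∑ i, z i * b i) 0 with hb | hb
  · exact claim2 i0 hi0 z hz hz0 hzA hb
  · have := claim2 i0 hi0 (-z) (fun i h => by simp [hz i h]) (by simp [hz0])
      (fun j => by simp [hzA j]) (by simpa using hb)
    simpa using this

theorem fm_sum_le_prod {κ : Type} (s : Finset κ) (f : κ → ℤ) (hf : ∀ i, 0 ≤ f i) :
    ∑ i ∈ s, f i + 1 ≤ ∏ i ∈ s, (f i + 1) := by
  classical
  induction s using Finset.induction_on with
  | empty => simp
  | insert a s ha ih =>
    rw [Finset.sum_insert ha, Finset.prod_insert ha]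
    have : 0 ≤ ∑ i ∈ s, f i := Finset.sum_nonneg fun i _ => hf i
    nlinarith [hf a]

theorem fm_prod_inj {κ ι : Type} [Fintype κ] [Fintype ι] (g : κ → ι)
    (hg : Function.Injective g) (f : ι → ℤ) (hf : ∀ i, 1 ≤ f i) :
    ∏ k, f (g k) ≤ ∏ i, f i := by
  classical
  rw [← Finset.prod_image (s := Finset.univ) (g := g) (f := f) (fun a _ b _ h => hg h)]
  exact Finset.prod_le_prod_of_subset_of_one_le (Finset.subset_univ _)
    (fun i _ => by linarith [hf i]) (fun i _ _ => hf i)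

theorem fm_det_le {m n : ℕ} {κ : Type} [Fintype κ] [DecidableEq κ]
    (A : Matrix (Fin m) (Fin n) ℤ) (f : κ → Fin m) (g : κ → Fin n)
    (hf : Function.Injective f) (hg : Function.Injective g) :
    |(A.submatrix f g).det| ≤ ∏ i, ∏ j, (|A i j| + 1) := by
  classical
  have h1 : |(A.submatrix f g).det| ≤ ∑ σ : Equiv.Perm κ, ∏ k, |A (f k) (g (σ k))| := by
    rw [← Matrix.det_transpose, Matrix.det_apply]
    refine (Finset.abs_sum_le_sum_abs _ _).trans (Finset.sum_le_sum fun σ _ => ?_)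
    rw [Units.smul_def, smul_eq_mul, abs_mul, Finset.abs_prod]
    simp
  have h2 : ∑ σ : Equiv.Perm κ, ∏ k, |A (f k) (g (σ k))| ≤ ∏ k, ∑ l, |A (f k) (g l)| := by
    rw [Finset.prod_univ_sum, Fintype.piFinset_univ]
    rw [← Finset.sum_image (s := Finset.univ) (g := fun σ : Equiv.Perm κ => (σ : κ → κ))
      (f := fun p : κ → κ => ∏ k, |A (f k) (g (p k))|) (fun a _ b _ h => DFunLike.coe_injective h)]
    exact Finset.sum_le_sum_of_subset_of_nonneg (Finset.subset_univ _)
      (fun p _ _ => Finset.prod_nonneg fun k _ => abs_nonneg _)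
  have h3 : ∀ i, 1 ≤ ∏ j, (|A i j| + 1) := fun i =>
    Finset.one_le_prod (fun j _ => by linarith [abs_nonneg (A i j)])
  refine h1.trans (h2.trans ?_)
  refine le_trans (Finset.prod_le_prod (fun k _ => Finset.sum_nonneg fun l _ => abs_nonneg _)
    (fun k _ => ?_)) (fm_prod_inj f hf (fun i => ∏ j, (|A i j| + 1)) h3)
  have h4 := fm_sum_le_prod Finset.univ (fun l => |A (f k) (g l)|) (fun l => abs_nonneg _)
  have h5 := fm_prod_inj g hg (fun j => |A (f k) j| + 1) (fun j => by linarith [abs_nonneg (A (f k) j)])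
  linarith

theorem fm_nonsing {T : Type} [Fintype T] [DecidableEq T] {n : ℕ} (B : Matrix T (Fin n) ℝ)
    (hB : LinearIndependent ℝ B.row) :
    ∃ g : T → Fin n, Function.Injective g ∧ (B.submatrix id g).det ≠ 0 := by
  classical
  obtain ⟨κ, a, ha, hspan, hli⟩ := exists_linearIndependent' ℝ B.col
  have : Fintype κ := Fintype.ofInjective a ha
  have hr : B.rank = Fintype.card T := hB.rank_matrix
  rw [Matrix.rank_eq_finrank_span_cols, ← hspan, finrank_span_eq_card hli] at hr
  let e : T ≃ κ := (Fintype.equivOfCardEq hr).symm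
  refine ⟨a ∘ e, ha.comp e.injective, ?_⟩
  have h2 : LinearIndependent ℝ (B.submatrix id (a ∘ e)).col := hli.comp e e.injective
  rw [Matrix.linearIndependent_cols_iff_isUnit, Matrix.isUnit_iff_isUnit_det] at h2
  exact h2.ne_zero

open Matrix in
theorem fm_cramer {T : Type} [Fintype T] [DecidableEq T] (N : Matrix T T ℝ) (y c : T → ℝ)
    (h : ∀ j, ∑ i, y i * N i j = c j) (t : T) : N.det * y t = (N.updateRow t c).det := by
  have h' : Nᵀ.mulVec y = c := by
    ext j; rw [← h j]; simp [Matrix.mulVec, dotProduct, mul_comm]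
  rw [← Matrix.cramer_transpose_apply, ← h', Matrix.cramer_eq_adjugate_mulVec, Matrix.mulVec_mulVec,
    Matrix.adjugate_mul, Matrix.det_transpose, Matrix.smul_mulVec, Matrix.one_mulVec]
  simp

theorem fm_integral {m n : ℕ} (A : Matrix (Fin m) (Fin n) ℤ) (b : Fin m → ℤ)
    (h : ¬ ∃ x : Fin n → ℝ, ∀ i, ∑ j, (A i j : ℝ) * x j ≤ (b i : ℝ)) :
    ∃ w : Fin m → ℤ, (∀ i, 0 ≤ w i) ∧ (∀ i, w i ≤ ∏ i, ∏ j, (|A i j| + 1)) ∧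
      (∀ j, ∑ i, w i * A i j = 0) ∧ ∑ i, w i * b i < 0 := by
  classical
  obtain ⟨y, ⟨hy0, hyA, hyb⟩, hmin⟩ := fm_minimal (fun i j => (A i j : ℝ)) (fun i => (b i : ℝ))
    (fm_farkas n (Fin m) _ _ h)
  obtain ⟨i0, hi0⟩ : ∃ i0, y i0 ≠ 0 := by
    by_contra hcon
    push Not at hcon
    simp [hcon] at hyb
  let T := {i : Fin m // y i ≠ 0 ∧ i ≠ i0}
  let B : Matrix T (Fin n) ℝ := fun t j => (A t.1 j : ℝ)
  -- splitting sums
  have hsplit : ∀ (z c : Fin m → ℝ), (∀ i, y i = 0 → z i = 0) →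
      ∑ i, z i * c i = z i0 * c i0 + ∑ t : T, z t.1 * c t.1 := by
    intro z c hz
    rw [← Finset.add_sum_erase Finset.univ _ (Finset.mem_univ i0)]
    congr 1
    rw [← Finset.sum_subtype ((Finset.univ.erase i0).filter (fun i => y i ≠ 0))
      (p := fun i => y i ≠ 0 ∧ i ≠ i0) (fun i => by simp [and_comm]) (fun i => z i * c i)]
    symm
    apply Finset.sum_subset (Finset.filter_subset _ _)
    intro i hi hi'
    have : y i = 0 := by
      by_contra hne
      exact hi' (Finset.mem_filter.mpr ⟨hi, hne⟩)
    simp [hz i this]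
  have hB : LinearIndependent ℝ B.row := by
    rw [Fintype.linearIndependent_iff]
    intro g hg t
    let z : Fin m → ℝ := fun i => if hi : y i ≠ 0 ∧ i ≠ i0 then g ⟨i, hi⟩ else 0
    have hz1 : ∀ i, y i = 0 → z i = 0 := fun i hi => by simp [z, hi]
    have hz2 : z i0 = 0 := by simp [z]
    have hzt : ∀ t : T, z t.1 = g t := fun t => by simp only [z]; rw [dif_pos t.2]
    have := hmin i0 hi0 z hz1 hz2 (fun j => by
      rw [hsplit z _ hz1, hz2, zero_mul, zero_add]
      have h2 := congrFun hg j
      rw [Finset.sum_apply] at h2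
      simp_rw [hzt]
      exact h2)
    rw [← hzt t, this]; rfl
  obtain ⟨g, hg, hdet⟩ := fm_nonsing B hB
  set N : Matrix T T ℤ := A.submatrix (fun t : T => t.1) g with hN
  have hNB : B.submatrix id g = N.map (Int.cast : ℤ → ℝ) := by ext; rfl
  have hNdet : (B.submatrix id g).det = ((N.det : ℤ) : ℝ) := by
    rw [hNB]; exact (Int.cast_det N).symm
  have hdetZ : N.det ≠ 0 := by
    rw [hNdet] at hdet; exact_mod_cast hdet
  have hypos : 0 < y i0 := lt_of_le_of_ne (hy0 i0) (Ne.symm hi0)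
  have hcr : ∀ t : T, (N.det : ℝ) * y t.1 =
      -y i0 * (((N.updateRow t (fun k => A i0 (g k))).det : ℤ) : ℝ) := by
    intro t
    have h1 := fm_cramer (B.submatrix id g) (fun t => y t.1) ((-y i0) • fun k => (A i0 (g k) : ℝ))
      (by
        intro k
        have h2 := hyA (g k)
        rw [hsplit y _ (fun i hi => hi)] at h2
        change ∑ t : T, y t.1 * (A t.1 (g k) : ℝ) = -y i0 * (A i0 (g k) : ℝ)
        linarith) t
    rw [← hNdet, h1, Matrix.det_updateRow_smul, Int.cast_det]
    congr 2
    ext k l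
    simp only [Matrix.map_apply, Matrix.updateRow_apply]
    split_ifs <;> rfl
  have hw : ∀ i, ∃ k : ℤ, |(N.det : ℝ)| / y i0 * y i = k ∧ k ≤ ∏ i, ∏ j, (|A i j| + 1) := by
    intro i
    by_cases hii : i = i0
    · subst hii
      refine ⟨|N.det|, ?_, fm_det_le A _ g Subtype.val_injective hg⟩
      push_cast; field_simp
    by_cases hyi : y i = 0
    · exact ⟨0, by simp [hyi], Finset.prod_nonneg fun i _ => Finset.prod_nonneg fun j _ => by positivity⟩
    · let t : T := ⟨i, hyi, hii⟩
      have hup : N.updateRow t (fun k => A i0 (g k)) =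
          A.submatrix (Function.update (fun t : T => t.1) t i0) g := by
        ext k l
        rw [Matrix.updateRow_apply, Matrix.submatrix_apply, Function.update_apply]
        split_ifs <;> rfl
      have hinj : Function.Injective (Function.update (fun t : T => t.1) t i0) := by
        intro p q hpq
        simp only [Function.update_apply] at hpq
        split_ifs at hpq with h1 h2 h2
        · rw [h1, h2]
        · exact absurd hpq.symm q.2.2
        · exact absurd hpq p.2.2
        · exact Subtype.ext hpq
      have hle := fm_det_le A _ g hinj hg
      rw [← hup] at hle
      have hc := hcr t
      change (N.det : ℝ) * y i = _ at hc
      set D := (N.updateRow t (fun k => A i0 (g k))).det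
      rcases lt_or_gt_of_ne hdetZ with hs | hs
      · refine ⟨D, ?_, (le_abs_self _).trans hle⟩
        rw [abs_of_neg (by exact_mod_cast hs), div_mul_eq_mul_div, div_eq_iff hi0]
        linarith
      · refine ⟨-D, ?_, (neg_le_abs _).trans hle⟩
        rw [abs_of_pos (by exact_mod_cast hs), div_mul_eq_mul_div, div_eq_iff hi0]
        rw [Int.cast_neg]
        linarith
  choose w hw1 hw2 using hw
  have hcpos : 0 < |(N.det : ℝ)| / y i0 :=
    div_pos (abs_pos.mpr (by exact_mod_cast hdetZ)) hypos
  refine ⟨w, fun i => ?_, hw2, fun j => ?_, ?_⟩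
  · have : (0 : ℝ) ≤ w i := by rw [← hw1]; exact mul_nonneg hcpos.le (hy0 i)
    exact_mod_cast this
  · have : ((∑ i, w i * A i j : ℤ) : ℝ) = 0 := by
      push_cast
      simp_rw [← hw1, mul_assoc]
      rw [← Finset.mul_sum, hyA j, mul_zero]
    exact_mod_cast this
  · have : ((∑ i, w i * b i : ℤ) : ℝ) < 0 := by
      push_cast
      simp_rw [← hw1, mul_assoc]
      rw [← Finset.mul_sum]
      exact mul_neg_of_pos_of_neg hcpos hyb
    exact_mod_cast this

/-- An infeasible rational (integer) system `Ax ≤ b` cannot be violated by an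
arbitrarily small amount: every point has maximum violation at least `2·2^{-σ}`,
where `σ` is the binary encoding length of the data. -/
theorem infeasible_min_violation {m n : ℕ} (hm : 0 < m) (hn : 0 < n)
    (A : Matrix (Fin m) (Fin n) ℤ) (b : Fin m → ℤ) (σ : ℝ)
    (hσ : σ = (∑ i, ∑ j, Real.logb 2 ((|A i j| : ℝ) + 1)) +
        (∑ i, Real.logb 2 ((|b i| : ℝ) + 1)) + Real.logb 2 ((n : ℝ) * (m : ℝ)) + 2)
    (hinfeas : ¬ ∃ x : Fin n → ℝ, ∀ i, ∑ j, (A i j : ℝ) * x j ≤ (b i : ℝ)) :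
    ∀ x : Fin n → ℝ,
      2 * (2 : ℝ) ^ (-σ) ≤ max 0 (⨆ i, (∑ j, (A i j : ℝ) * x j - (b i : ℝ))) := by
  intro x
  obtain ⟨w, hw0, hwP, hwA, hwb⟩ := fm_integral A b hinfeas
  set θ := max 0 (⨆ i, (∑ j, (A i j : ℝ) * x j - (b i : ℝ))) with hθ
  have hθ0 : 0 ≤ θ := le_max_left _ _
  have hθi : ∀ i, ∑ j, (A i j : ℝ) * x j - (b i : ℝ) ≤ θ := fun i =>
    (le_ciSup (f := fun i => ∑ j, (A i j : ℝ) * x j - (b i : ℝ))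
      (Set.finite_range _).bddAbove i).trans (le_max_right _ _)
  set P : ℝ := ∏ i, ∏ j, ((|A i j| : ℝ) + 1) with hP
  set Q : ℝ := ∏ i, ((|b i| : ℝ) + 1) with hQ
  have hPpos : 0 < P := Finset.prod_pos fun i _ => Finset.prod_pos fun j _ => by positivity
  have hQ1 : 1 ≤ Q := by
    rw [hQ]
    apply Finset.prod_induction _ (fun z : ℝ => 1 ≤ z)
    · exact fun a b ha hb => one_le_mul_of_one_le_of_one_le ha hb
    · exact le_refl _
    · intro i _
      linarith [abs_nonneg (b i : ℝ)]
  have hn1 : (1 : ℝ) ≤ n := by exact_mod_cast hn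
  have hm1 : (1 : ℝ) ≤ m := by exact_mod_cast hm
  have hwP' : ∀ i, (w i : ℝ) ≤ P := by
    intro i
    have : ((w i : ℤ) : ℝ) ≤ ((∏ i, ∏ j, (|A i j| + 1) : ℤ) : ℝ) := by exact_mod_cast hwP i
    rw [hP]; push_cast at this; exact this
  have hone : 1 ≤ ∑ i, (w i : ℝ) * (∑ j, (A i j : ℝ) * x j - (b i : ℝ)) := by
    have h1 : ∑ i, (w i : ℝ) * (∑ j, (A i j : ℝ) * x j) = 0 := by
      rw [show ∑ i, (w i : ℝ) * (∑ j, (A i j : ℝ) * x j) =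
        ∑ j, (∑ i, (w i : ℝ) * (A i j : ℝ)) * x j by
          simp_rw [Finset.mul_sum, Finset.sum_mul]
          rw [Finset.sum_comm]
          simp_rw [mul_assoc]]
      apply Finset.sum_eq_zero
      intro j _
      have : ∑ i, (w i : ℝ) * (A i j : ℝ) = 0 := by exact_mod_cast hwA j
      rw [this, zero_mul]
    have h2 : ∑ i, (w i : ℝ) * (b i : ℝ) ≤ -1 := by
      have : ∑ i, w i * b i ≤ -1 := by omega
      exact_mod_cast this
    simp_rw [mul_sub]
    rw [Finset.sum_sub_distrib, h1]
    linarith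
  have hbound : 1 ≤ m * P * θ := by
    calc (1 : ℝ) ≤ ∑ i, (w i : ℝ) * (∑ j, (A i j : ℝ) * x j - (b i : ℝ)) := hone
      _ ≤ ∑ i : Fin m, P * θ := Finset.sum_le_sum fun i _ =>
          (mul_le_mul_of_nonneg_left (hθi i) (by exact_mod_cast hw0 i)).trans
            (mul_le_mul_of_nonneg_right (hwP' i) hθ0)
      _ = m * P * θ := by simp [mul_assoc]
  have hpow : (2 : ℝ) ^ σ = P * Q * (n * m) * 4 := by
    have hpos : 0 < P * Q * (n * m) * 4 := by positivity
    have : σ = Real.logb 2 (P * Q * (n * m) * 4) := by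
      rw [Real.logb_mul (by positivity) (by norm_num), Real.logb_mul (by positivity) (by positivity),
        Real.logb_mul (by positivity) (by positivity), hσ, hP, hQ,
        Real.logb_prod _ _ (fun i _ => by positivity), Real.logb_prod _ _ (fun i _ => by positivity)]
      congr 1
      · congr 3
        ext i
        rw [Real.logb_prod _ _ (fun j _ => by positivity)]
      · rw [show (4 : ℝ) = 2 ^ (2 : ℝ) by norm_num, Real.logb_rpow (by norm_num) (by norm_num)]
    rw [this, Real.rpow_logb (by norm_num) (by norm_num) hpos]
  rw [Real.rpow_neg (by norm_num), hpow, ← div_eq_mul_inv, div_le_iff₀ (by positivity)]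
  have h5 : (1 : ℝ) ≤ Q * n := one_le_mul_of_one_le_of_one_le hQ1 hn1
  calc (2 : ℝ) ≤ 4 * (1 * 1) := by norm_num
    _ ≤ 4 * ((Q * n) * (m * P * θ)) := by gcongr
    _ = θ * (P * Q * (n * m) * 4) := by ring
end

section
/- Let A be an m×n integer matrix, b ∈ ℤᵐ, and define the binary encoding length σ = Σ_{i,j} log₂(|A_{ij}| + 1) + Σ_i log₂(|b_i| + 1) + log₂(nm) + 2. If the system Ax ≤ b has a solution x ∈ ℝⁿ, then it has a solution x̂ ∈ ℝⁿ whose coordinates satisfy |x̂_j| ≤ 2^σ/(2n) for j = 1,…,n. -/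
/-- A matrix with trivial kernel has an invertible square row-submatrix. -/
theorem row_select {T S : Type} [Fintype T] [Fintype S] [DecidableEq S]
    (M : Matrix T S ℝ) (h : Function.Injective M.mulVec) :
    ∃ e : S → T, Function.Injective e ∧ (M.submatrix e id).det ≠ 0 := by
  classical
  obtain ⟨κ, a, ha, hspan, hli⟩ := exists_linearIndependent' ℝ M.row
  have : Finite κ := Finite.of_injective a ha
  have := Fintype.ofFinite κ
  have hc : Fintype.card κ = Fintype.card S := by
    rw [linearIndependent_iff_card_eq_finrank_span] at hli
    rw [hli, Set.finrank, hspan, ← Matrix.rank_eq_finrank_span_row, ← Matrix.rank_transpose]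
    exact (Matrix.mulVec_injective_iff.1 h).rank_matrix
  let f : S ≃ κ := (Fintype.equivOfCardEq hc).symm
  refine ⟨a ∘ f, ha.comp f.injective, ?_⟩
  have h2 : LinearIndependent ℝ (M.submatrix (a ∘ f) id).row :=
    hli.comp f f.injective
  rw [Matrix.linearIndependent_rows_iff_isUnit, Matrix.isUnit_iff_isUnit_det] at h2
  exact h2.ne_zero

/-- Determinant bound by the product of the row sums. -/
theorem det_bound {S : Type} [Fintype S] [DecidableEq S] (M : Matrix S S ℝ) :
    |M.det| ≤ ∏ i, ∑ j, |M i j| := by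
  rw [← Matrix.det_transpose, Matrix.det_apply]
  refine (Finset.abs_sum_le_sum_abs _ _).trans ?_
  rw [Finset.prod_univ_sum]
  have : ∀ σ : Equiv.Perm S, |Equiv.Perm.sign σ • ∏ i, M.transpose (σ i) i|
      = ∏ i, |M i (σ i)| := by
    intro σ
    rcases Int.units_eq_one_or (Equiv.Perm.sign σ) with h | h <;>
      simp [h, Finset.abs_prod]
  simp only [this]
  refine (Finset.sum_map Finset.univ
    (⟨fun σ : Equiv.Perm S => (σ : S → S), DFunLike.coe_injective⟩ : Equiv.Perm S ↪ (S → S))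
    (fun f : S → S => ∏ i, |M i (f i)|)).symm.le.trans ?_
  refine Finset.sum_le_sum_of_subset_of_nonneg (by intro; simp) ?_
  intros
  exact Finset.prod_nonneg fun _ _ => abs_nonneg _

theorem sum_le_prod_one_add {S : Type} (s : Finset S) (f : S → ℝ)
    (hf : ∀ i, 0 ≤ f i) : 1 + ∑ i ∈ s, f i ≤ ∏ i ∈ s, (f i + 1) := by
  classical
  induction s using Finset.induction_on with
  | empty => simp
  | insert a s ha ih =>
    rw [Finset.sum_insert ha, Finset.prod_insert ha]
    have := Finset.sum_nonneg (fun i (_ : i ∈ s) => hf i)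
    nlinarith [hf a, mul_nonneg (hf a) this, mul_le_mul_of_nonneg_left ih (hf a)]

/-- One step to a vertex-like point. -/
theorem step {K : Type} [Fintype K] (s v : K → ℝ)
    (h0 : ∀ k, s k = 0 → v k = 0) (hne : ∃ k, s k * v k < 0) :
    ∃ t : ℝ, (∀ k, 0 ≤ s k → 0 ≤ s k + t * v k) ∧
      (∀ k, s k = 0 → s k + t * v k = 0) ∧ ∃ k, s k ≠ 0 ∧ s k + t * v k = 0 := by
  classical
  obtain ⟨k, hk, hmin⟩ := Finset.exists_min_image
    (Finset.univ.filter fun k => s k * v k < 0) (fun k => - s k / v k)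
    (by obtain ⟨k, hk⟩ := hne; exact ⟨k, by simpa using hk⟩)
  have hk' : s k * v k < 0 := by simpa using hk
  have hv : v k ≠ 0 := by rintro h; simp [h] at hk'
  have hs : s k ≠ 0 := by rintro h; simp [h] at hk'
  have hpos : 0 < - s k / v k := by
    have : - s k / v k = -(s k * v k) / (v k)^2 := by field_simp
    rw [this]; exact div_pos (by linarith) (by positivity)
  refine ⟨- s k / v k, ?_, ?_, k, hs, by field_simp; ring⟩
  · intro l hl
    rcases le_or_gt 0 (v l) with h | h
    · positivity
    · rcases hl.eq_or_lt with h1 | h1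
      · rw [h0 l h1.symm, ← h1]; simp
      · have := hmin l (by simpa using mul_neg_of_pos_of_neg h1 h)
        have h3 := mul_le_mul_of_nonpos_right this h.le
        rw [div_mul_cancel₀ _ h.ne] at h3
        linarith
  · intro l hl
    rw [hl, h0 l hl]; simp

/-- Existence of a feasible point such that tight rows and vanishing coordinates determine it. -/
theorem exists_vertex {m n : ℕ} (A : Matrix (Fin m) (Fin n) ℝ) (b : Fin m → ℝ)
    (hfeas : ∃ x : Fin n → ℝ, ∀ i, ∑ j, A i j * x j ≤ b i) :
    ∃ x : Fin n → ℝ, (∀ i, ∑ j, A i j * x j ≤ b i) ∧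
      ∀ d : Fin n → ℝ, (∀ i, ∑ j, A i j * x j = b i → ∑ j, A i j * d j = 0) →
        (∀ j, x j = 0 → d j = 0) → d = 0 := by
  classical
  let F : (Fin n → ℝ) → Fin m ⊕ Fin n → ℝ := fun x =>
    Sum.elim (fun i => b i - ∑ j, A i j * x j) x
  let c : (Fin n → ℝ) → ℕ := fun x => (Finset.univ.filter fun k => F x k ≠ 0).card
  have hex : ∃ N, ∃ x : Fin n → ℝ, (∀ i, ∑ j, A i j * x j ≤ b i) ∧ c x = N := by
    obtain ⟨x, hx⟩ := hfeas
    exact ⟨_, x, hx, rfl⟩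
  obtain ⟨x, hx, hc⟩ := Nat.find_spec hex
  have hmin : ∀ y : Fin n → ℝ, (∀ i, ∑ j, A i j * y j ≤ b i) → c x ≤ c y := by
    intro y hy
    rw [hc]; exact Nat.find_min' hex ⟨y, hy, rfl⟩
  refine ⟨x, hx, ?_⟩
  have main : ∀ d : Fin n → ℝ, (∀ i, ∑ j, A i j * x j = b i → ∑ j, A i j * d j = 0) →
        (∀ j, x j = 0 → d j = 0) → ∀ j, ¬ x j * d j < 0 := by
    intro d h1 h2 j hj
    let v : Fin m ⊕ Fin n → ℝ := Sum.elim (fun i => - ∑ j, A i j * d j) d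
    obtain ⟨t, ht1, ht2, k, hk, hk2⟩ := step (F x) v (by
      rintro (i | j) h
      · have := h1 i (by simp only [F, Sum.elim_inl] at h; linarith)
        simp [v, this]
      · exact h2 j h) ⟨Sum.inr j, hj⟩
    have hF : ∀ k, F x k + t * v k = F (fun j => x j + t * d j) k := by
      rintro (i | j)
      · simp only [F, v, Sum.elim_inl, mul_add, Finset.sum_add_distrib]
        have : ∑ j, A i j * (t * d j) = t * ∑ j, A i j * d j := by
          rw [Finset.mul_sum]; exact Finset.sum_congr rfl fun _ _ => by ring
        rw [this]; ring
      · rfl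
    simp only [hF] at ht1 ht2 hk2
    have hle := hmin (fun j => x j + t * d j) (by
      intro i
      have := ht1 (Sum.inl i) (by simp only [F, Sum.elim_inl]; linarith [hx i])
      simp only [F, Sum.elim_inl] at this; linarith)
    refine absurd hle (not_le.2 (Finset.card_lt_card ?_))
    rw [Finset.ssubset_iff_of_subset]
    · exact ⟨k, by simpa using hk, by simpa using hk2⟩
    · intro l
      simp only [Finset.mem_filter, Finset.mem_univ, true_and]
      exact fun h h' => h (ht2 l h')
  intro d h1 h2
  funext j
  by_contra hd
  have hd' : d j ≠ 0 := hd
  have hxj : x j ≠ 0 := fun h => hd (h2 j h)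
  rcases lt_or_gt_of_ne (mul_ne_zero hxj hd') with h | h
  · exact main d h1 h2 j h
  · refine main (-d) (fun i hi => ?_) (fun j hj => by simp [h2 j hj]) j ?_
    · simp [h1 i hi]
    · simp only [Pi.neg_apply]; linarith


/-- A feasible rational (integer) system `Ax ≤ b` has a feasible point whose
coordinates are bounded by `2^σ/(2n)`, where `σ` is the binary encoding length
of the data. -/
theorem feasible_bounded_solution {m n : ℕ} (hm : 0 < m) (hn : 0 < n)
    (A : Matrix (Fin m) (Fin n) ℤ) (b : Fin m → ℤ) (σ : ℝ)
    (hσ : σ = (∑ i, ∑ j, Real.logb 2 ((|A i j| : ℝ) + 1)) +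
        (∑ i, Real.logb 2 ((|b i| : ℝ) + 1)) + Real.logb 2 ((n : ℝ) * (m : ℝ)) + 2)
    (hfeas : ∃ x : Fin n → ℝ, ∀ i, ∑ j, (A i j : ℝ) * x j ≤ (b i : ℝ)) :
    ∃ x : Fin n → ℝ, (∀ i, ∑ j, (A i j : ℝ) * x j ≤ (b i : ℝ)) ∧
      ∀ j, |x j| ≤ (2 : ℝ) ^ σ / (2 * (n : ℝ)) := by
  classical
  obtain ⟨x, hx, huniq⟩ := exists_vertex (A.map (Int.cast : ℤ → ℝ)) (fun i => (b i : ℝ)) hfeas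
  simp only [Matrix.map_apply] at hx huniq
  refine ⟨x, hx, ?_⟩
  -- the bound
  let g : Fin m → ℝ := fun i => (∏ j, (|(A i j : ℝ)| + 1)) * (|(b i : ℝ)| + 1)
  have hp1 : ∀ i, 1 ≤ ∏ j, (|(A i j : ℝ)| + 1) := fun i => by
    have := sum_le_prod_one_add Finset.univ (fun j => |(A i j : ℝ)|) (fun _ => abs_nonneg _)
    have h2 : 0 ≤ ∑ j, |(A i j : ℝ)| := Finset.sum_nonneg fun _ _ => abs_nonneg _
    linarith
  have hg1 : ∀ i, 1 ≤ g i := fun i =>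
    one_le_mul_of_one_le_of_one_le (hp1 i) (by linarith [abs_nonneg (b i : ℝ)])
  have hm1 : (1 : ℝ) ≤ m := by exact_mod_cast hm
  have hn1 : (1 : ℝ) ≤ n := by exact_mod_cast hn
  have hpow : (2 : ℝ) ^ σ = (∏ i, g i) * (n * m) * 4 := by
    have e : ∀ y : ℝ, 0 < y → (2 : ℝ) ^ Real.logb 2 y = y := fun y hy =>
      Real.rpow_logb (by norm_num) (by norm_num) hy
    rw [hσ, Real.rpow_add two_pos, Real.rpow_add two_pos, Real.rpow_add two_pos,
      e _ (by positivity), Real.rpow_sum_of_pos two_pos, Real.rpow_sum_of_pos two_pos]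
    simp only [Real.rpow_sum_of_pos two_pos]
    have e1 : ∀ i j, (2 : ℝ) ^ Real.logb 2 (|(A i j : ℝ)| + 1) = |(A i j : ℝ)| + 1 :=
      fun i j => e _ (by positivity)
    have e2 : ∀ i, (2 : ℝ) ^ Real.logb 2 (|(b i : ℝ)| + 1) = |(b i : ℝ)| + 1 :=
      fun i => e _ (by positivity)
    simp only [e1, e2, g, Finset.prod_mul_distrib]
    norm_num
  have hG : 1 ≤ ∏ i, g i := by
    have := Finset.prod_le_prod (s := Finset.univ) (f := fun _ : Fin m => (1 : ℝ)) (g := g)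
      (fun _ _ => zero_le_one) (fun i _ => hg1 i)
    simpa using this
  have hbig : ∏ i, g i ≤ (2 : ℝ) ^ σ / (2 * (n : ℝ)) := by
    rw [hpow, le_div_iff₀ (by positivity)]
    have : 0 ≤ (∏ i, g i) * n := by positivity
    nlinarith
  -- Cramer
  let T := {i : Fin m // ∑ j, (A i j : ℝ) * x j = b i}
  let S := {j : Fin n // x j ≠ 0}
  let M : Matrix T S ℤ := fun i j => A i.1 j.1
  have hsum : ∀ (i : Fin m) (d : Fin n → ℝ), (∀ j, x j = 0 → d j = 0) →
      ∑ j, (A i j : ℝ) * d j = ∑ j : S, (A i j.1 : ℝ) * d j.1 := by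
    intro i d hd
    rw [← Finset.sum_subtype (Finset.univ.filter fun j => x j ≠ 0) (by simp)
      (fun j => (A i j : ℝ) * d j)]
    symm
    refine Finset.sum_subset (Finset.subset_univ _) fun j _ hj => ?_
    rw [hd j (by simpa using hj), mul_zero]
  obtain ⟨e, he, hdet⟩ := row_select (M.map (Int.cast : ℤ → ℝ)) (by
    have hinj : Function.Injective (M.map (Int.cast : ℤ → ℝ)).mulVecLin := by
      rw [injective_iff_map_eq_zero]
      intro w hw
      let d : Fin n → ℝ := fun j => if h : x j ≠ 0 then w ⟨j, h⟩ else 0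
      have hd0 : ∀ j, x j = 0 → d j = 0 := fun j hj => by simp [d, hj]
      have hdS : ∀ j : S, d j.1 = w j := fun j => by simp [d, j.2]
      have := huniq d (fun i hi => by
        rw [hsum i d hd0]
        have := congrFun hw ⟨i, hi⟩
        simp only [Matrix.mulVecLin_apply, Matrix.mulVec, dotProduct, Matrix.map_apply, M] at this
        simp only [hdS]
        exact this) hd0
      funext j
      rw [← hdS, this]; rfl
    exact hinj)
  let B : Matrix S S ℤ := M.submatrix e id
  let BR : Matrix S S ℝ := (M.map (Int.cast : ℤ → ℝ)).submatrix e id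
  have hBR : BR.det = (B.det : ℝ) := by
    rw [Int.cast_det]; rfl
  have hdet1 : 1 ≤ |BR.det| := by
    have h0 : BR.det ≠ 0 := hdet
    rw [hBR] at h0 ⊢
    have : B.det ≠ 0 := by exact_mod_cast h0
    exact_mod_cast Int.one_le_abs this
  let y : S → ℝ := fun j => x j.1
  let c : S → ℝ := fun i => (b (e i).1 : ℝ)
  have hBy : BR.mulVec y = c := by
    funext i
    have := hsum (e i).1 x (fun _ h => h)
    rw [(e i).2] at this
    exact this.symm
  have hcr : ∀ j, BR.det * y j = (BR.updateCol j c).det := by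
    intro j
    rw [← Matrix.cramer_apply, Matrix.cramer_eq_adjugate_mulVec, ← hBy, Matrix.mulVec_mulVec,
      Matrix.adjugate_mul, Matrix.smul_mulVec, Matrix.one_mulVec]
    rfl
  have hrow : ∀ (j i : S), ∑ l, |BR.updateCol j c i l| ≤ g (e i).1 := by
    intro j i
    have h1 : ∑ l, |BR.updateCol j c i l| ≤ |c i| + ∑ l, |BR i l| := by
      rw [← Finset.add_sum_erase _ _ (Finset.mem_univ j)]
      rw [Matrix.updateCol_self]
      gcongr
      refine (Finset.sum_le_sum (g := fun l => |BR i l|) fun l hl => ?_).trans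
        (Finset.sum_le_sum_of_subset_of_nonneg (Finset.erase_subset j _)
          fun _ _ _ => abs_nonneg _)
      rw [Matrix.updateCol_ne (Finset.ne_of_mem_erase hl)]
    have h2 : ∑ l, |BR i l| ≤ ∑ j, |(A (e i).1 j : ℝ)| := by
      have : ∑ l, |BR i l| = ∑ j ∈ Finset.univ.filter (fun j => x j ≠ 0), |(A (e i).1 j : ℝ)| :=
        (Finset.sum_subtype (Finset.univ.filter fun j => x j ≠ 0) (by simp)
          (fun j => |(A (e i).1 j : ℝ)|)).symm
      rw [this]
      exact Finset.sum_le_sum_of_subset_of_nonneg (Finset.subset_univ _)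
          fun _ _ _ => abs_nonneg _
    have h3 := sum_le_prod_one_add Finset.univ (fun j => |(A (e i).1 j : ℝ)|)
      (fun _ => abs_nonneg _)
    have h4 : c i = (b (e i).1 : ℝ) := rfl
    rw [h4] at h1
    have h5 := hp1 (e i).1
    simp only [g]
    nlinarith [abs_nonneg (b (e i).1 : ℝ)]
  have hfin : ∀ j : S, |x j.1| ≤ ∏ i, g i := by
    intro j
    have h1 : |BR.det| * |x j.1| ≤ ∏ i : S, g (e i).1 := by
      rw [← abs_mul]
      have := hcr j
      simp only [y] at this
      rw [this]
      refine (det_bound _).trans ?_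
      exact Finset.prod_le_prod (fun i _ => Finset.sum_nonneg fun _ _ => abs_nonneg _)
        fun i _ => hrow j i
    have h2 : ∏ i : S, g (e i).1 ≤ ∏ i, g i := by
      refine (Finset.prod_map Finset.univ
        (⟨fun i : S => (e i).1, Subtype.val_injective.comp he⟩ : S ↪ Fin m) g).symm.le.trans ?_
      exact Finset.prod_le_prod_of_subset_of_one_le (Finset.subset_univ _)
        (fun i _ => by linarith [hg1 i]) (fun i _ _ => hg1 i)
    nlinarith [abs_nonneg (x j.1)]
  intro j
  by_cases hj : x j = 0
  · rw [hj, abs_zero]; linarith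
  · exact (hfin ⟨j, hj⟩).trans hbig
end

section
/- Let A be an m×n integer matrix with nonzero rows a_1,…,a_m, let b ∈ ℤᵐ, and define σ = Σ_{i,j} log₂(|A_{ij}| + 1) + Σ_i log₂(|b_i| + 1) + log₂(nm) + 2. Consider the normalized system with rows ã_i = a_i/‖a_i‖ and right-hand sides b̃_i = b_i/‖a_i‖, and its maximum violation θ̃(x) = max{0, max_i (ã_iᵀx − b̃_i)}. If the system Ax ≤ b is infeasible over ℝⁿ, then for every x ∈ ℝⁿ, θ̃(x) ≥ 2^{1−σ} / (max_{j∈[m]} ‖a_j‖). Consequently, any point x with θ̃(x) < 2^{1−σ}/(max_j ‖a_j‖) is a certificate of feasibility of Ax ≤ b. -/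
open scoped RealInnerProductSpace

/-- The Farkas lemma, proved by induction on the rows. -/
theorem farkas_aux {V ι : Type*} [AddCommGroup V] [Module ℝ V] [DecidableEq ι] (s : Finset ι) :
    ∀ (f : ι → (V →ₗ[ℝ] ℝ)) (c : V →ₗ[ℝ] ℝ),
      (∀ x, (∀ i ∈ s, f i x ≤ 0) → c x ≤ 0) →
      ∃ y : ι → ℝ, (∀ i, 0 ≤ y i) ∧ c = ∑ i ∈ s, y i • f i := by
  induction s using Finset.induction_on with
  | empty =>
    intro f c h
    refine ⟨fun _ => 0, fun _ => le_rfl, ?_⟩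
    ext x
    have h1 := h x (by simp)
    have h2 := h (-x) (by simp)
    simp at h2 ⊢
    linarith
  | insert k s hk ih =>
    intro f c h
    by_cases hc : ∀ x, (∀ i ∈ s, f i x ≤ 0) → c x ≤ 0
    · obtain ⟨y, hy, e⟩ := ih f c hc
      refine ⟨fun i => if i = k then 0 else y i, fun i => by dsimp only; split_ifs; exacts [le_rfl, hy i], ?_⟩
      rw [Finset.sum_insert hk, e]
      simp only [if_true, zero_smul, zero_add]
      refine Finset.sum_congr rfl fun i hi => ?_
      rw [if_neg (by rintro rfl; exact hk hi)]
    · push Not at hc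
      obtain ⟨x1, hx1, hcx1⟩ := hc
      have hkx : 0 < f k x1 := by
        by_contra hcon
        push Not at hcon
        have := h x1 (by
          intro i hi
          rcases Finset.mem_insert.1 hi with rfl | hi
          · exact hcon
          · exact hx1 i hi)
        linarith
      obtain ⟨x0, h01, h02, h03⟩ : ∃ x0, f k x0 = 1 ∧ (∀ i ∈ s, f i x0 ≤ 0) ∧ 0 < c x0 := by
        refine ⟨(f k x1)⁻¹ • x1, ?_, ?_, ?_⟩
        · simp [hkx.ne']
        · intro i hi
          simp only [map_smul, smul_eq_mul]
          exact mul_nonpos_of_nonneg_of_nonpos (by positivity) (hx1 i hi)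
        · simp only [map_smul, smul_eq_mul]
          positivity
      obtain ⟨y, hy, e⟩ := ih (fun i => f i - f i x0 • f k) (c - c x0 • f k) (by
        intro x hx
        have := h (x - f k x • x0) (by
          intro i hi
          rcases Finset.mem_insert.1 hi with rfl | hi
          · simp [h01]
          · have := hx i hi
            simp at this ⊢
            linarith)
        simp at this ⊢
        linarith)
      have hneg : ∑ i ∈ s, y i * f i x0 ≤ 0 :=
        Finset.sum_nonpos fun i hi => mul_nonpos_of_nonneg_of_nonpos (hy i) (h02 i hi)
      refine ⟨fun i => if i = k then c x0 - ∑ i ∈ s, y i * f i x0 else y i, fun i => ?_, ?_⟩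
      · dsimp only
        split_ifs
        · linarith
        · exact hy i
      · rw [Finset.sum_insert hk]
        have : ∑ i ∈ s, (if i = k then c x0 - ∑ i ∈ s, y i * f i x0 else y i) • f i
            = ∑ i ∈ s, y i • f i := by
          refine Finset.sum_congr rfl fun i hi => ?_
          rw [if_neg (by rintro rfl; exact hk hi)]
        rw [this]
        ext x
        have ex := congrArg (fun g : V →ₗ[ℝ] ℝ => g x) e
        simp [LinearMap.sum_apply, mul_sub, Finset.sum_sub_distrib] at ex ⊢
        have h5 : ∑ i ∈ s, y i * (f i x0 * f k x) = (∑ i ∈ s, y i * f i x0) * f k x := by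
          rw [Finset.sum_mul]
          exact Finset.sum_congr rfl fun i _ => by ring
        rw [h5] at ex
        linarith

theorem one_add_sum_le_prod_aux {ι : Type*} (s : Finset ι) (f : ι → ℝ) (hf : ∀ i, 0 ≤ f i) :
    1 + ∑ i ∈ s, f i ≤ ∏ i ∈ s, (f i + 1) := by
  classical
  induction s using Finset.induction_on with
  | empty => simp
  | insert k s hk ih =>
    rw [Finset.sum_insert hk, Finset.prod_insert hk]
    have h1 : 0 ≤ ∑ i ∈ s, f i := Finset.sum_nonneg fun i _ => hf i
    nlinarith [hf k]

theorem abs_det_le_aux {ι : Type*} [Fintype ι] [DecidableEq ι] (N : Matrix ι ι ℝ) :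
    |N.det| ≤ ∏ i, ∏ j, (|N i j| + 1) := by
  rw [← Matrix.det_transpose, Matrix.det_apply]
  calc |∑ p : Equiv.Perm ι, Equiv.Perm.sign p • ∏ i, N.transpose (p i) i|
      ≤ ∑ p : Equiv.Perm ι, |Equiv.Perm.sign p • ∏ i, N.transpose (p i) i| :=
        Finset.abs_sum_le_sum_abs _ _
    _ = ∑ p : Equiv.Perm ι, ∏ i, |N i (p i)| := by
        refine Finset.sum_congr rfl fun p _ => ?_
        rcases Int.units_eq_one_or (Equiv.Perm.sign p) with h | h <;>
          simp [h, Finset.abs_prod]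
    _ = ∑ q ∈ Finset.univ.map ⟨fun p : Equiv.Perm ι => (p : ι → ι), DFunLike.coe_injective⟩,
          ∏ i, |N i (q i)| := by
        rw [Finset.sum_map]; rfl
    _ ≤ ∑ q : ι → ι, ∏ i, |N i (q i)| :=
        Finset.sum_le_sum_of_subset_of_nonneg (Finset.subset_univ _)
          (fun q _ _ => Finset.prod_nonneg fun i _ => abs_nonneg _)
    _ = ∏ i, ∑ j, |N i j| := by
        rw [Finset.prod_univ_sum]; simp
    _ ≤ ∏ i, ∏ j, (|N i j| + 1) := by
        refine Finset.prod_le_prod (fun i _ => Finset.sum_nonneg fun j _ => abs_nonneg _) ?_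
        intro i _
        have := one_add_sum_le_prod_aux Finset.univ (fun j => |N i j|) (fun j => abs_nonneg _)
        linarith

theorem li_bound_aux {ι κ : Type*} [Fintype ι] [DecidableEq ι] [Fintype κ] [DecidableEq κ]
    (R : Matrix ι κ ℤ) (c : κ) (y : ι → ℝ)
    (hli : LinearIndependent ℝ (R.map (Int.cast : ℤ → ℝ)).row)
    (hy : ∀ j, ∑ i, y i * (R i j : ℝ) = if j = c then 1 else 0) (i : ι) :
    |y i| ≤ 2 * ∏ i, ∏ j, (|(R i j : ℝ)| + 1) := by
  set M := R.map (Int.cast : ℤ → ℝ) with hM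
  have hr := hli.rank_matrix
  rw [Matrix.rank_eq_finrank_span_cols] at hr
  obtain ⟨τ, a, ainj, hspan, hali⟩ := exists_linearIndependent' ℝ M.col
  have : Finite τ := Finite.of_injective a ainj
  have := Fintype.ofFinite τ
  have hcard : Fintype.card ι = Fintype.card τ := by
    rw [← hr, ← hspan, finrank_span_eq_card hali]
  let e : ι ≃ τ := Fintype.equivOfCardEq hcard
  let N : Matrix ι ι ℤ := fun i j => R i (a (e j))
  have hNli : LinearIndependent ℝ (N.map (Int.cast : ℤ → ℝ)).col :=
    hali.comp e e.injective
  rw [Matrix.linearIndependent_cols_iff_isUnit, Matrix.isUnit_iff_isUnit_det] at hNli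
  set NR := N.map (Int.cast : ℤ → ℝ) with hNR
  have hdet : NR.det = (N.det : ℝ) := by
    rw [hNR]; exact (Int.cast_det N).symm
  have hd1 : 1 ≤ |NR.det| := by
    have h0 : N.det ≠ 0 := by
      intro h; rw [hdet, h] at hNli; simp at hNli
    rw [hdet]
    exact_mod_cast Int.one_le_abs h0
  let w : ι → ℝ := fun j => if a (e j) = c then 1 else 0
  have hw : NR.transpose.mulVec y = w := by
    ext j
    have := hy (a (e j))
    simp only [Matrix.mulVec, dotProduct, w, ← this]
    exact Finset.sum_congr rfl fun i _ => mul_comm _ _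
  have hcr : NR.det * y i = (NR.updateRow i w).det := by
    have h1 : NR.transpose.cramer w = NR.det • y := by
      rw [Matrix.cramer_eq_adjugate_mulVec, ← hw, Matrix.mulVec_mulVec, Matrix.adjugate_mul,
        Matrix.smul_mulVec, Matrix.one_mulVec, Matrix.det_transpose]
    have h2 := congrFun h1 i
    rw [Matrix.cramer_transpose_apply] at h2
    rw [h2]; simp
  have hwp : ∏ j, (|w j| + 1) ≤ 2 := by
    by_cases hj : ∃ j0, a (e j0) = c
    · obtain ⟨j0, hj0⟩ := hj
      rw [Finset.prod_eq_single j0]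
      · simp only [w, hj0, if_true]; norm_num
      · intro j _ hne
        have : a (e j) ≠ c := fun h => hne (e.injective (ainj (h.trans hj0.symm)))
        simp [w, this]
      · simp
    · push Not at hj
      have : ∀ j, |w j| + 1 = 1 := fun j => by simp [w, hj j]
      simp [this]
  have hrow1 : ∀ i', 1 ≤ ∏ j, (|(R i' j : ℝ)| + 1) := fun i' => by
    have := one_add_sum_le_prod_aux Finset.univ (fun j => |(R i' j : ℝ)|) (fun j => abs_nonneg _)
    have h0 : 0 ≤ ∑ j, |(R i' j : ℝ)| := Finset.sum_nonneg fun j _ => abs_nonneg _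
    linarith
  calc |y i| ≤ |NR.det| * |y i| := le_mul_of_one_le_left (abs_nonneg _) hd1
    _ = |(NR.updateRow i w).det| := by rw [← abs_mul, hcr]
    _ ≤ ∏ i', ∏ j, (|NR.updateRow i w i' j| + 1) := abs_det_le_aux _
    _ ≤ ∏ i', ((if i' = i then 2 else 1) * ∏ j, (|(R i' j : ℝ)| + 1)) := by
        refine Finset.prod_le_prod (fun i' _ => Finset.prod_nonneg fun j _ => by positivity) ?_
        intro i' _
        by_cases h : i' = i
        · subst h
          simp only [Matrix.updateRow_self, if_true]
          nlinarith [hrow1 i']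
        · simp only [Matrix.updateRow_ne h, if_neg h, one_mul]
          have : ∏ j, (|NR i' j| + 1)
              = ∏ k ∈ Finset.univ.map ⟨fun j => a (e j), ainj.comp e.injective⟩,
                (|(R i' k : ℝ)| + 1) := by
            rw [Finset.prod_map]; rfl
          rw [this]
          refine Finset.prod_le_prod_of_subset_of_one_le (Finset.subset_univ _)
            (fun k _ => by positivity) (fun k _ _ => ?_)
          linarith [abs_nonneg (R i' k : ℝ)]
    _ = 2 * ∏ i, ∏ j, (|(R i j : ℝ)| + 1) := by
        rw [Finset.prod_mul_distrib]; simp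

theorem basic_aux {ι κ : Type*} [Fintype ι] [DecidableEq ι] [Fintype κ] [DecidableEq κ]
    (R : Matrix ι κ ℤ) (c : κ) (k : ℕ) : ∀ (y : ι → ℝ)
    (_ : (Finset.univ.filter fun i => y i ≠ 0).card ≤ k)
    (_ : ∀ i, 0 ≤ y i)
    (_ : ∀ j, ∑ i, y i * (R i j : ℝ) = if j = c then 1 else 0),
    ∃ y' : ι → ℝ, (∀ i, 0 ≤ y' i) ∧
      (∀ j, ∑ i, y' i * (R i j : ℝ) = if j = c then 1 else 0) ∧
      ∀ i, y' i ≤ 2 * ∏ i, ∏ j, (|(R i j : ℝ)| + 1) := by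
  induction k with
  | zero =>
    intro y hk hy0 hy
    exfalso
    have hz : ∀ i, y i = 0 := by
      intro i
      have := Finset.card_eq_zero.1 (Nat.le_zero.1 hk)
      by_contra h
      have h2 : i ∈ (Finset.univ.filter fun i => y i ≠ 0) := by simp [h]
      rw [this] at h2
      simp at h2
    have := hy c
    simp [hz] at this
  | succ k ih =>
    intro y hk hy0 hy
    let S := Finset.univ.filter fun i => y i ≠ 0
    have hrow1 : ∀ i', 1 ≤ ∏ j, (|(R i' j : ℝ)| + 1) := fun i' => by
      have := one_add_sum_le_prod_aux Finset.univ (fun j => |(R i' j : ℝ)|) (fun j => abs_nonneg _)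
      have h0 : 0 ≤ ∑ j, |(R i' j : ℝ)| := Finset.sum_nonneg fun j _ => abs_nonneg _
      linarith
    let RS : Matrix S κ ℤ := fun i j => R i j
    by_cases hli : LinearIndependent ℝ (RS.map (Int.cast : ℤ → ℝ)).row
    · refine ⟨y, hy0, hy, ?_⟩
      have key := li_bound_aux RS c (fun i => y i) hli (by
        intro j
        rw [← hy j]
        have : ∑ i ∈ S, y i * (R i j : ℝ) = ∑ i, y i * (R i j : ℝ) := by
          refine Finset.sum_subset (Finset.subset_univ _) fun i _ hi => ?_
          have : y i = 0 := by simpa [S] using hi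
          simp [this]
        rw [← this, ← Finset.sum_coe_sort S])
      have hprod : ∏ i : S, ∏ j, (|(RS i j : ℝ)| + 1) ≤ ∏ i, ∏ j, (|(R i j : ℝ)| + 1) := by
        have h1 : ∏ i : S, ∏ j, (|(RS i j : ℝ)| + 1) = ∏ i ∈ S, ∏ j, (|(R i j : ℝ)| + 1) :=
          Finset.prod_coe_sort S (fun i => ∏ j, (|(R i j : ℝ)| + 1))
        rw [h1]
        exact Finset.prod_le_prod_of_subset_of_one_le (Finset.subset_univ _)
          (fun i _ => by linarith [hrow1 i]) (fun i _ _ => hrow1 i)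
      intro i
      by_cases hi : y i = 0
      · rw [hi]; positivity
      · have := key ⟨i, by simp [S, hi]⟩
        have h2 := le_abs_self (y i)
        simp only at this
        linarith
    · rw [Fintype.not_linearIndependent_iff] at hli
      obtain ⟨g, hg, ⟨i1, hi1⟩⟩ := hli
      obtain ⟨z, hz, hzS, i1, hi1⟩ : ∃ z : ι → ℝ, (∀ j, ∑ i, z i * (R i j : ℝ) = 0) ∧
          (∀ i, y i = 0 → z i = 0) ∧ ∃ i, 0 < z i := by
        let z0 : ι → ℝ := fun i => if h : i ∈ S then g ⟨i, h⟩ else 0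
        have hz0 : ∀ j, ∑ i, z0 i * (R i j : ℝ) = 0 := by
          intro j
          have h1 : ∑ i ∈ S, z0 i * (R i j : ℝ) = ∑ i, z0 i * (R i j : ℝ) := by
            refine Finset.sum_subset (Finset.subset_univ _) fun i _ hi => ?_
            simp [z0, hi]
          rw [← h1, ← Finset.sum_coe_sort S]
          have h2 := congrFun hg j
          simp only [Finset.sum_apply, Pi.smul_apply, smul_eq_mul, Pi.zero_apply] at h2
          rw [← h2]
          refine Finset.sum_congr rfl fun i _ => ?_
          have : z0 i = g i := by simp [z0]
          rw [this]; rfl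
        have hzS : ∀ i, y i = 0 → z0 i = 0 := fun i h => by simp [z0, S, h]
        have hne : z0 i1 ≠ 0 := by
          simpa [z0] using hi1
        rcases lt_or_gt_of_ne hne with h | h
        · refine ⟨fun i => - z0 i, fun j => ?_, fun i h => by simp [hzS i h], i1, by simpa using h⟩
          simp [hz0 j]
        · exact ⟨z0, hz0, hzS, i1, h⟩
      obtain ⟨i0, hi0, hmin⟩ := Finset.exists_min_image
        (Finset.univ.filter fun i => 0 < z i) (fun i => y i / z i) ⟨i1, by simp [hi1]⟩
      have hzi0 : 0 < z i0 := by simpa using hi0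
      set t := y i0 / z i0 with ht
      have ht0 : 0 ≤ t := div_nonneg (hy0 _) hzi0.le
      refine ih (fun i => y i - t * z i) ?_ ?_ ?_
      · have hlt : (Finset.univ.filter fun i => y i - t * z i ≠ 0).card < S.card := by
          refine Finset.card_lt_card ?_
          rw [Finset.ssubset_iff_of_subset]
          · refine ⟨i0, ?_, ?_⟩
            · simp only [S, Finset.mem_filter, Finset.mem_univ, true_and]
              intro h; rw [hzS _ h] at hzi0; exact lt_irrefl _ hzi0
            · simp only [Finset.mem_filter, Finset.mem_univ, true_and, not_not]
              rw [ht]; field_simp; ring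
          · intro i hi
            simp only [S, Finset.mem_filter, Finset.mem_univ, true_and] at hi ⊢
            intro h; apply hi; rw [h, hzS _ h]; ring
        have : S.card ≤ k + 1 := hk
        omega
      · intro i
        rcases le_or_gt (z i) 0 with h | h
        · have := hy0 i
          nlinarith [mul_nonneg ht0 (neg_nonneg.2 h)]
        · have := hmin i (by simp [h])
          have h3 : t * z i ≤ y i := (le_div_iff₀ h).1 this
          linarith
      · intro j
        simp only [sub_mul, Finset.sum_sub_distrib, hy j, mul_assoc, ← Finset.mul_sum, hz j]
        simp

/-- For an infeasible integer system `Ax ≤ b` with nonzero rows, the maximum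
violation of the row-normalized system is at least `2^{1-σ}/max_j ‖a_j‖` at
every point; hence any point with smaller normalized violation certifies
feasibility. -/
theorem infeasible_normalized_min_violation {m n : ℕ} (hm : 0 < m) (hn : 0 < n)
    (A : Matrix (Fin m) (Fin n) ℤ) (b : Fin m → ℤ)
    (a : Fin m → EuclideanSpace ℝ (Fin n))
    (ha : ∀ i, a i = (WithLp.equiv 2 (Fin n → ℝ)).symm (fun j => (A i j : ℝ)))
    (ha0 : ∀ i, a i ≠ 0)
    (σ : ℝ)
    (hσ : σ = (∑ i, ∑ j, Real.logb 2 ((|A i j| : ℝ) + 1)) +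
        (∑ i, Real.logb 2 ((|b i| : ℝ) + 1)) + Real.logb 2 ((n : ℝ) * (m : ℝ)) + 2)
    (hinfeas : ¬ ∃ x : EuclideanSpace ℝ (Fin n), ∀ i, ⟪a i, x⟫ ≤ (b i : ℝ)) :
    ∀ x : EuclideanSpace ℝ (Fin n),
      (2 : ℝ) ^ (1 - σ) / (⨆ j, ‖a j‖) ≤
        max 0 (⨆ i, (⟪a i, x⟫ - (b i : ℝ)) / ‖a i‖) := by
  intro x
  have hm' : (0 : ℝ) < m := by exact_mod_cast hm
  have hn' : (1 : ℝ) ≤ n := by exact_mod_cast hn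
  have hinner : ∀ i (x : EuclideanSpace ℝ (Fin n)), ⟪a i, x⟫ = ∑ j, (A i j : ℝ) * x j := by
    intro i x
    rw [ha i]
    simp [PiLp.inner_apply, mul_comm]
  set P : ℝ := (∏ i, ∏ j, (|(A i j : ℝ)| + 1)) * ∏ i, (|(b i : ℝ)| + 1) with hP
  have hP0 : 0 < P := by
    refine mul_pos (Finset.prod_pos fun i _ => Finset.prod_pos fun j _ => ?_)
      (Finset.prod_pos fun i _ => ?_) <;> positivity
  have hpow : (2 : ℝ) ^ (1 - σ) = 1 / (2 * n * m * P) := by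
    have h2σ : σ = Real.logb 2 (P * (n * m) * 4) := by
      rw [Real.logb_mul (by positivity) (by norm_num), Real.logb_mul hP0.ne' (by positivity), hP,
        Real.logb_mul, Real.logb_prod, Real.logb_prod, hσ]
      · have h4 : Real.logb 2 4 = 2 := by
          rw [show (4 : ℝ) = 2 ^ (2 : ℝ) by norm_num]
          exact Real.logb_rpow (by norm_num) (by norm_num)
        rw [h4]
        have h5 : ∀ i, Real.logb 2 (∏ j, (|(A i j : ℝ)| + 1)) =
            ∑ j, Real.logb 2 ((|A i j| : ℝ) + 1) := by
          intro i
          rw [Real.logb_prod]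
          intro j _; positivity
        simp only [h5]
      · intro i _; positivity
      · intro i _; exact (Finset.prod_pos fun j _ => by positivity).ne'
      · exact (Finset.prod_pos fun i _ => Finset.prod_pos fun j _ => by positivity).ne'
      · exact (Finset.prod_pos fun j _ => by positivity).ne'
    rw [Real.rpow_sub (by norm_num), h2σ, Real.rpow_logb (by norm_num) (by norm_num) (by positivity)]
    rw [Real.rpow_one]
    field_simp
    norm_num
  -- Farkas certificate
  let F : Option (Fin m) → (((Fin n → ℝ) × ℝ) →ₗ[ℝ] ℝ) := fun i =>
    match i with
    | none => - LinearMap.snd ℝ _ _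
    | some i => (∑ j, (A i j : ℝ) • (LinearMap.proj j ∘ₗ LinearMap.fst ℝ (Fin n → ℝ) ℝ))
        - (b i : ℝ) • LinearMap.snd ℝ _ _
  have hF0 : ∀ u, F none u = - u.2 := fun u => rfl
  have hF1 : ∀ i u, F (some i) u = ∑ j, (A i j : ℝ) * u.1 j - b i * u.2 := by
    intro i u
    simp [F, LinearMap.sum_apply]
  obtain ⟨y0, hy0, he⟩ := farkas_aux Finset.univ F (LinearMap.snd ℝ _ _) (by
    rintro ⟨u, t⟩ hu
    by_contra hcon
    have ht : 0 < t := not_le.1 hcon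
    apply hinfeas
    refine ⟨WithLp.toLp 2 (fun j => u j / t), fun i => ?_⟩
    rw [hinner]
    have := hu (some i) (Finset.mem_univ _)
    rw [hF1] at this
    simp only at this
    have h2 : ∑ j, (A i j : ℝ) * (u j / t) = (∑ j, (A i j : ℝ) * u j) / t := by
      rw [Finset.sum_div]
      exact Finset.sum_congr rfl fun j _ => by ring
    simp only [h2]
    rw [div_le_iff₀ ht]
    linarith)
  have hev : ∀ u : (Fin n → ℝ) × ℝ, u.2 = - (y0 none * u.2) +
      ∑ i, y0 (some i) * (∑ j, (A i j : ℝ) * u.1 j - b i * u.2) := by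
    intro u
    have := congrArg (fun g : ((Fin n → ℝ) × ℝ) →ₗ[ℝ] ℝ => g u) he
    simpa [LinearMap.sum_apply, Fintype.sum_option, hF0, hF1] using this
  let R : Matrix (Fin m) (Option (Fin n)) ℤ := fun i j =>
    match j with
    | none => - b i
    | some j => A i j
  have hs : 0 < 1 + y0 none := by linarith [hy0 none]
  obtain ⟨y, hyn, hy, hyb⟩ := basic_aux R none m (fun i => y0 (some i) / (1 + y0 none))
    (by simpa using Finset.card_le_univ (Finset.univ.filter fun i : Fin m => _))
    (fun i => div_nonneg (hy0 _) hs.le) (by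
      intro j
      simp only [div_mul_eq_mul_div]
      rw [← Finset.sum_div]
      cases j with
      | none =>
        have h := hev (0, 1)
        simp at h
        simp only [R, if_true]
        rw [div_eq_one_iff_eq hs.ne']
        push_cast
        simp only [mul_neg, Finset.sum_neg_distrib]
        linarith
      | some j =>
        have h := hev (Pi.single j 1, 0)
        simp [Pi.single_apply] at h
        simp [R, ← h])
  have hRP : ∏ i, ∏ j, (|(R i j : ℝ)| + 1) = P := by
    simp only [Fintype.prod_option, Finset.prod_mul_distrib, R, hP]
    rw [mul_comm]
    simp
  rw [hRP] at hyb
  have hsum : ∑ i, y i ≤ 2 * n * m * P := by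
    calc ∑ i, y i ≤ ∑ _i : Fin m, 2 * P := Finset.sum_le_sum fun i _ => hyb i
      _ = 1 * (2 * m * P) := by simp; ring
      _ ≤ n * (2 * m * P) := mul_le_mul_of_nonneg_right hn' (by positivity)
      _ = _ := by ring
  have hone : ∑ i, y i * (⟪a i, x⟫ - b i) = 1 := by
    have h1 : ∑ i, y i * ⟪a i, x⟫ = 0 := by
      simp only [hinner, Finset.mul_sum]
      rw [Finset.sum_comm]
      refine Finset.sum_eq_zero fun j _ => ?_
      have := hy (some j)
      simp only [R] at this
      simp only [← mul_assoc]
      rw [← Finset.sum_mul, this]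
      simp
    have h2 := hy none
    simp [R] at h2
    simp only [mul_sub, Finset.sum_sub_distrib, h1]
    linarith
  have : Nonempty (Fin m) := ⟨⟨0, hm⟩⟩
  obtain ⟨i0, hi0⟩ := Finite.exists_max (fun i => ⟪a i, x⟫ - (b i : ℝ))
  set v := ⟪a i0, x⟫ - (b i0 : ℝ) with hv
  have hsv : 1 ≤ (∑ i, y i) * v := by
    rw [← hone, Finset.sum_mul]
    exact Finset.sum_le_sum fun i _ => mul_le_mul_of_nonneg_left (hi0 i) (hyn i)
  have hs0 : 0 ≤ ∑ i, y i := Finset.sum_nonneg fun i _ => hyn i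
  have hv0 : 0 < v := by
    by_contra h
    push Not at h
    nlinarith [mul_nonneg hs0 (neg_nonneg.2 h)]
  have hmain : (2 : ℝ) ^ (1 - σ) ≤ v := by
    rw [hpow, div_le_iff₀ (by positivity)]
    nlinarith [mul_le_mul_of_nonneg_right hsum hv0.le]
  have hna : 0 < ‖a i0‖ := norm_pos_iff.2 (ha0 i0)
  calc (2 : ℝ) ^ (1 - σ) / (⨆ j, ‖a j‖) ≤ v / ‖a i0‖ :=
        div_le_div₀ hv0.le hmain hna (le_ciSup (f := fun j => ‖a j‖) (Set.finite_range _).bddAbove i0)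
    _ ≤ ⨆ i, (⟪a i, x⟫ - (b i : ℝ)) / ‖a i‖ :=
        le_ciSup (f := fun i => (⟪a i, x⟫ - (b i : ℝ)) / ‖a i‖) (Set.finite_range _).bddAbove i0
    _ ≤ _ := le_max_right _ _
end
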